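/- Let Ω ⊂ ℝⁿ be a bounded domain with smooth boundary and let u ∈ C⁰(closure(Ω)) ∩ C²(Ω) with 0 ≤ u < 1 in Ω be a stable solution of −Δu = f(u) in Ω with u = 0 on ∂Ω, where f ∈ C²([0,1)) satisfies f ≥ 0, f′ ≥ 0, f″ ≥ 0, lim_{t→1⁻} f(t) = +∞, and there exist θ > 0, K ≥ 0, K̃ ≥ 0 such that f″(t)f(t) ≥ (1+θ)f′(t)² − K and f″(t)(f(t)−f(0)) ≥ (1+θ)f′(t)² − K̃ for all 0 ≤ t < 1. For every β ∈ (0, √(1+θ) − 1), setting p̄ = (2+β)·2n/(n−2) when n ≥ 3 (and p̄ ≥ 1 arbitrary when n ≤ 2), one has ‖f(u)‖_{L^{p̄}(Ω)} ≤ C ( f(0) + ‖f′(u)f(u)‖_{L¹(Ω)} ), where C depends only on Ω, θ, K, K̃, β, and p̄. -/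

import Mathlib

open MeasureTheory Set Filter Topology Bornology Metric

/-- The Laplacian of `u : ℝⁿ → ℝ`, as the sum of second partial derivatives. -/
noncomputable def lap {n : ℕ} (u : EuclideanSpace ℝ (Fin n) → ℝ)
    (x : EuclideanSpace ℝ (Fin n)) : ℝ :=
  ∑ i, fderiv ℝ (fun y => fderiv ℝ u y (EuclideanSpace.single i 1)) x (EuclideanSpace.single i 1)

/-- `f` is of class `C²([0,1))`, with first and second derivatives `f'`, `f''`. -/
def C2On01 (f f' f'' : ℝ → ℝ) : Prop :=
  (∀ t ∈ Ico (0:ℝ) 1, HasDerivWithinAt f (f' t) (Ico (0:ℝ) 1) t) ∧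
  (∀ t ∈ Ico (0:ℝ) 1, HasDerivWithinAt f' (f'' t) (Ico (0:ℝ) 1) t) ∧
  ContinuousOn f'' (Ico (0:ℝ) 1)

/-- Stability of a solution `u` of `-Δu = f(u)` in `Ω`: nonnegativity of the second variation of
the energy on all smooth test functions compactly supported in `Ω`. Here `f'` is the derivative
of the nonlinearity. -/
def StableSol {n : ℕ} (f' : ℝ → ℝ) (u : EuclideanSpace ℝ (Fin n) → ℝ)
    (Ω : Set (EuclideanSpace ℝ (Fin n))) : Prop :=
  ∀ ξ : EuclideanSpace ℝ (Fin n) → ℝ, ContDiff ℝ (⊤:ℕ∞) ξ → HasCompactSupport ξ →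
    tsupport ξ ⊆ Ω →
    0 ≤ ∫ x in Ω, (‖gradient ξ x‖ ^ 2 - f' (u x) * ξ x ^ 2)

/-- A bounded domain (open, connected) in `ℝⁿ` with smooth boundary, described by a smooth
defining function `ρ` whose gradient does not vanish on the boundary. -/
def SmoothBoundedDomain {n : ℕ} (Ω : Set (EuclideanSpace ℝ (Fin n))) : Prop :=
  IsOpen Ω ∧ IsBounded Ω ∧ IsConnected Ω ∧
  ∃ ρ : EuclideanSpace ℝ (Fin n) → ℝ, ContDiff ℝ (⊤:ℕ∞) ρ ∧ Ω = {x | ρ x < 0} ∧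
    ∀ x ∈ frontier Ω, fderiv ℝ ρ x ≠ 0

open scoped NNReal ENNReal

theorem sobolev_inequality_one {w : EuclideanSpace ℝ (Fin 1) → ℝ} (hw : ContDiff ℝ 1 w)
    (hc : HasCompactSupport w) (x : EuclideanSpace ℝ (Fin 1)) :
    ‖w x‖ₑ ≤ ∫⁻ y, ‖fderiv ℝ w y‖ₑ := by
  set e : EuclideanSpace ℝ (Fin 1) := EuclideanSpace.single 0 1
  have he : ‖e‖ = 1 := by simp [e]
  have hx : x = x 0 • e := by
    ext i; fin_cases i; simp [e]
  have hderiv : ∀ t : ℝ, deriv (fun s : ℝ => w (s • e)) t = fderiv ℝ w (t • e) e := fun t => by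
    have h1 : HasDerivAt (fun s : ℝ => s • e) e t := by
      simpa using (hasDerivAt_id t).smul_const e
    exact (((hw.differentiable one_ne_zero) (t • e)).hasFDerivAt.comp_hasDerivAt t h1).deriv
  have hemb : IsClosedEmbedding (fun s : ℝ => s • e) :=
    isClosedEmbedding_smul_left (by rw [← norm_ne_zero_iff, he]; norm_num)
  have hcw : HasCompactSupport (fun s : ℝ => w (s • e)) := hc.comp_isClosedEmbedding hemb
  have hmp : MeasurePreserving (fun s : ℝ => s • e) volume volume := by
    have h1 := (volume_preserving_funUnique (Fin 1) ℝ).symm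
    have h2 := (EuclideanSpace.volume_preserving_symm_measurableEquiv_toLp (Fin 1)).symm
    have h3 : (fun s : ℝ => s • e) = (MeasurableEquiv.toLp 2 (Fin 1 → ℝ)) ∘
        (MeasurableEquiv.funUnique (Fin 1) ℝ).symm := by
      funext s
      ext i
      fin_cases i
      simp [e]
    rw [h3]
    exact h2.comp h1
  calc ‖w x‖ₑ = ‖w (x 0 • e)‖ₑ := by rw [← hx]
    _ ≤ ∫⁻ t in Iic (x 0), ‖deriv (fun s : ℝ => w (s • e)) t‖ₑ :=
        hcw.enorm_le_lintegral_Ici_deriv (by fun_prop) (x 0)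
    _ ≤ ∫⁻ t : ℝ, ‖deriv (fun s : ℝ => w (s • e)) t‖ₑ := setLIntegral_le_lintegral _ _
    _ ≤ ∫⁻ t : ℝ, ‖fderiv ℝ w (t • e)‖ₑ := by
        refine lintegral_mono fun t => ?_
        rw [hderiv, enorm_le_iff_norm_le]
        simpa [he] using (fderiv ℝ w (t • e)).le_opNorm e
    _ = ∫⁻ y, ‖fderiv ℝ w y‖ₑ :=
        hmp.lintegral_comp_emb hemb.measurableEmbedding (fun y => ‖fderiv ℝ w y‖ₑ)

theorem eLpNorm_le_mul_eLpNorm_of_support_subset {E F : Type*} [MeasurableSpace E]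
    [NormedAddCommGroup F] {μ : Measure E} {g : E → F} {s : Set E} (hg : AEStronglyMeasurable g μ)
    (hs : Function.support g ⊆ s) {p q : ℝ≥0∞} (hpq : p ≤ q) :
    eLpNorm g p μ ≤ eLpNorm g q μ * μ s ^ (1 / p.toReal - 1 / q.toReal) := by
  rw [← eLpNorm_restrict_eq_of_support_subset hs, ← eLpNorm_restrict_eq_of_support_subset (p := q) hs]
  simpa using eLpNorm_le_eLpNorm_mul_rpow_measure_univ hpq (hg.restrict (s := s))

theorem sobolev_inequality {n : ℕ} (hn : 1 ≤ n) {Ω : Set (EuclideanSpace ℝ (Fin n))}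
    (hΩ : IsBounded Ω) {q : ℝ≥0} (hq : 2 ≤ q) (hqn : (2 : ℝ)⁻¹ - (n : ℝ)⁻¹ ≤ (q : ℝ)⁻¹) :
    ∃ C : ℝ≥0, ∀ w : EuclideanSpace ℝ (Fin n) → ℝ, ContDiff ℝ 1 w → tsupport w ⊆ Ω →
      eLpNorm w q volume ≤ C * eLpNorm (fderiv ℝ w) 2 volume := by
  have hvol : volume Ω ≠ ⊤ := hΩ.measure_lt_top.ne
  have hsupp : ∀ w : EuclideanSpace ℝ (Fin n) → ℝ, tsupport w ⊆ Ω →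
      Function.support (fderiv ℝ w) ⊆ Ω := fun w h => (support_fderiv_subset ℝ).trans h
  have hcont : ∀ w : EuclideanSpace ℝ (Fin n) → ℝ, ContDiff ℝ 1 w →
      AEStronglyMeasurable (fderiv ℝ w) volume := fun w h =>
    (h.continuous_fderiv one_ne_zero).aestronglyMeasurable
  rcases lt_or_ge 2 n with h3 | h3
  · refine ⟨eLpNormLESNormFDerivOfLeConst ℝ volume Ω 2 q, fun w hw hs => ?_⟩
    exact eLpNorm_le_eLpNorm_fderiv_of_le (p := 2) volume hw ((subset_tsupport w).trans hs)
      (by norm_num) (by simpa using h3) (by simpa using hqn) hΩ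
  · obtain rfl | rfl : n = 1 ∨ n = 2 := by omega
    · refine ⟨(volume Ω ^ (1 / (2 : ℝ)) * volume Ω ^ (1 / (q : ℝ))).toNNReal, fun w hw hs => ?_⟩
      have hc : HasCompactSupport w := 
        Metric.isCompact_of_isClosed_isBounded (isClosed_tsupport w) (hΩ.subset hs)
      rw [ENNReal.coe_toNNReal (by finiteness)]
      have h1 : eLpNorm (fderiv ℝ w) 1 volume ≤ eLpNorm (fderiv ℝ w) 2 volume *
          volume Ω ^ (1 / (2 : ℝ)) := by
        have := eLpNorm_le_mul_eLpNorm_of_support_subset (p := 1) (q := 2) (hcont w hw) (hsupp w hs)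
          (by norm_num)
        refine this.trans (le_of_eq ?_)
        norm_num
      have h2 := eLpNorm_le_mul_eLpNorm_of_support_subset (μ := volume) (p := q) (q := ⊤)
        hw.continuous.aestronglyMeasurable ((subset_tsupport w).trans hs) le_top
      have h3 : eLpNorm w ⊤ volume ≤ eLpNorm (fderiv ℝ w) 1 volume := by
        rw [eLpNorm_exponent_top, eLpNorm_one_eq_lintegral_enorm]
        exact eLpNormEssSup_le_of_ae_enorm_bound
          (Eventually.of_forall (sobolev_inequality_one hw hc))
      calc eLpNorm w q volume ≤ eLpNorm w ⊤ volume * volume Ω ^ (1 / (q : ℝ)) := by simpa using h2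
        _ ≤ (eLpNorm (fderiv ℝ w) 2 volume * volume Ω ^ (1 / (2 : ℝ))) * volume Ω ^ (1 / (q : ℝ)) := by
            gcongr; exact h3.trans h1
        _ = _ := by ring
    · have hq0 : (0 : ℝ≥0) < q := lt_of_lt_of_le (by norm_num) hq
      set p : ℝ≥0 := 2 * q / (q + 2) with hp
      have hp1 : 1 ≤ p := by
        rw [hp, le_div_iff₀ (by positivity)]
        linarith
      have hp2 : p < 2 := by
        rw [hp, div_lt_iff₀ (by positivity)]
        have : (0 : ℝ≥0) < 4 := by norm_num
        linarith
      refine ⟨(eLpNormLESNormFDerivOfLeConst ℝ volume Ω p q *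
        volume Ω ^ (1 / (p : ℝ) - 1 / 2)).toNNReal, fun w hw hs => ?_⟩
      have h1 : 0 ≤ 1 / (p : ℝ) - 1 / 2 := by
        have : (p : ℝ) < 2 := by exact_mod_cast hp2
        have : (1 : ℝ) ≤ p := by exact_mod_cast hp1
        rw [sub_nonneg]
        apply one_div_le_one_div_of_le <;> linarith
      rw [ENNReal.coe_toNNReal (by finiteness)]
      have h2 := eLpNorm_le_eLpNorm_fderiv_of_le (p := p) (q := q) volume hw
        ((subset_tsupport w).trans hs) hp1 (by simpa using hp2) (by
          rw [hp]
          have : (q : ℝ) ≠ 0 := by exact_mod_cast hq0.ne'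
          push_cast
          simp
          field_simp
          linarith) hΩ
      have h3 := eLpNorm_le_mul_eLpNorm_of_support_subset (p := p) (q := 2) (hcont w hw)
        (hsupp w hs) (by exact_mod_cast hp2.le)
      refine h2.trans ?_
      calc _ ≤ (eLpNormLESNormFDerivOfLeConst ℝ volume Ω p q : ℝ≥0∞) * (eLpNorm (fderiv ℝ w) 2 volume *
          volume Ω ^ (1 / (p : ℝ) - 1 / 2)) := by
            gcongr
            simpa using h3
        _ = _ := by ring

/-- Sobolev inequality for functions supported in a bounded set, including subcritical
exponents. -/
theorem sobolev_inequality_integral {n : ℕ} (hn : 1 ≤ n) {Ω : Set (EuclideanSpace ℝ (Fin n))}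
    (hΩ : IsBounded Ω) {q : ℝ} (hq : 2 ≤ q) (hqn : (2 : ℝ)⁻¹ - (n : ℝ)⁻¹ ≤ q⁻¹) :
    ∃ C : ℝ, 0 ≤ C ∧ ∀ w : EuclideanSpace ℝ (Fin n) → ℝ, ContDiff ℝ 1 w → tsupport w ⊆ Ω →
      (∫ x, |w x| ^ q) ^ (2 / q) ≤ C * ∫ x, ‖fderiv ℝ w x‖ ^ 2 := by
  lift q to ℝ≥0 using by linarith
  obtain ⟨C, hC⟩ := sobolev_inequality hn hΩ (q := q) (by exact_mod_cast hq) hqn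
  have hq0 : (0 : ℝ) < q := by linarith
  refine ⟨C ^ 2, by positivity, fun w hw hs => ?_⟩
  have hc : HasCompactSupport w :=
    Metric.isCompact_of_isClosed_isBounded (isClosed_tsupport w) (hΩ.subset hs)
  have h1 : MemLp w q volume := hw.continuous.memLp_of_hasCompactSupport hc
  have h2 : MemLp (fderiv ℝ w) 2 volume :=
    (hw.continuous_fderiv one_ne_zero).memLp_of_hasCompactSupport (hc.fderiv ℝ)
  have h := hC w hw hs
  rw [h1.eLpNorm_eq_integral_rpow_norm (by simpa using hq0.ne') (by simp),
    h2.eLpNorm_eq_integral_rpow_norm (by simp) (by simp), ← ENNReal.ofReal_coe_nnreal (p := C),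
    ← ENNReal.ofReal_mul (by positivity), ENNReal.ofReal_le_ofReal_iff (by positivity)] at h
  simp only [ENNReal.coe_toReal, ENNReal.toReal_ofNat, Real.norm_eq_abs, Real.rpow_ofNat] at h
  have hA : 0 ≤ ∫ x, |w x| ^ (q : ℝ) := integral_nonneg fun x => by positivity
  have hB : 0 ≤ ∫ x, ‖fderiv ℝ w x‖ ^ 2 := integral_nonneg fun x => by positivity
  calc (∫ x, |w x| ^ (q : ℝ)) ^ (2 / (q : ℝ)) = ((∫ x, |w x| ^ (q : ℝ)) ^ ((q : ℝ)⁻¹)) ^ 2 := by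
        rw [← Real.rpow_natCast, ← Real.rpow_mul hA]
        congr 1
        push_cast
        ring
    _ ≤ (C * (∫ x, ‖fderiv ℝ w x‖ ^ 2) ^ (2 : ℝ)⁻¹) ^ 2 := by gcongr
    _ = C ^ 2 * ∫ x, ‖fderiv ℝ w x‖ ^ 2 := by
        rw [mul_pow, ← Real.rpow_natCast (_ ^ (2 : ℝ)⁻¹), ← Real.rpow_mul hB]
        norm_num

open ContinuousLinearMap in
theorem precompR_lsmul {E : Type*} [NormedAddCommGroup E] [NormedSpace ℝ E] :
    (lsmul ℝ ℝ : ℝ →L[ℝ] ℝ →L[ℝ] ℝ).precompR E = (lsmul ℝ ℝ : ℝ →L[ℝ] (E →L[ℝ] ℝ) →L[ℝ] _) := by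
  ext c A
  simp

theorem norm_normed_convolution_le {E F : Type*} [NormedAddCommGroup E] [InnerProductSpace ℝ E]
    [FiniteDimensional ℝ E] [MeasurableSpace E] [BorelSpace E] [NormedAddCommGroup F]
    [NormedSpace ℝ F] [CompleteSpace F] (φ : ContDiffBump (0 : E)) {g : E → F} {B : ℝ}
    (hg : Continuous g) (hB : ∀ x, ‖g x‖ ≤ B) (x : E) :
    ‖convolution (φ.normed volume) g (ContinuousLinearMap.lsmul ℝ ℝ) volume x‖ ≤ B := by
  have := dist_convolution_le (x₀ := x) (μ := volume) (z₀ := (0 : F))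
    ((norm_nonneg _).trans (hB x)) φ.support_normed_eq.subset φ.nonneg_normed φ.integral_normed
    hg.aestronglyMeasurable (fun y _ => by simpa using hB y)
  simpa using this

theorem exists_smooth_approx {E : Type*} [NormedAddCommGroup E] [InnerProductSpace ℝ E]
    [FiniteDimensional ℝ E] [MeasurableSpace E] [BorelSpace E] {Ω : Set E} (hΩ : IsOpen Ω)
    {w : E → ℝ} (hw : ContDiff ℝ 1 w) (hc : HasCompactSupport w) (hs : tsupport w ⊆ Ω) :
    ∃ (v : ℕ → E → ℝ) (B : ℝ), (∀ j, ContDiff ℝ (⊤ : ℕ∞) (v j)) ∧ (∀ j, HasCompactSupport (v j)) ∧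
      (∀ j, tsupport (v j) ⊆ Ω) ∧ (∀ j x, |v j x| ≤ B) ∧ (∀ j x, ‖fderiv ℝ (v j) x‖ ≤ B) ∧
      (∀ x, Tendsto (fun j => v j x) atTop (𝓝 (w x))) ∧
      ∀ x, Tendsto (fun j => fderiv ℝ (v j) x) atTop (𝓝 (fderiv ℝ w x)) := by
  obtain ⟨δ, hδ, hδΩ⟩ := IsCompact.exists_cthickening_subset_open hc hΩ hs
  have hr : ∀ j : ℕ, 0 < δ / (j + 1) := fun j => by positivity
  let φ : ℕ → ContDiffBump (0 : E) := fun j =>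
    ⟨δ / (j + 1) / 2, δ / (j + 1), half_pos (hr j), half_lt_self (hr j)⟩
  have hφ : Tendsto (fun j => (φ j).rOut) atTop (𝓝 0) := by
    have := tendsto_one_div_add_atTop_nhds_zero_nat (𝕜 := ℝ)
    simpa [φ, div_eq_mul_inv] using this.const_mul δ
  have hφδ : ∀ j, (φ j).rOut ≤ δ := fun j => div_le_self hδ.le (by linarith [j.cast_nonneg (α := ℝ)])
  let μ : Measure E := volume
  let L : ℝ →L[ℝ] ℝ →L[ℝ] ℝ := ContinuousLinearMap.lsmul ℝ ℝ
  let v : ℕ → E → ℝ := fun j => convolution ((φ j).normed μ) w L μ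
  have hdcont : Continuous (fderiv ℝ w) := hw.continuous_fderiv one_ne_zero
  have hloc : ∀ j, LocallyIntegrable ((φ j).normed μ) μ := fun j =>
    ((φ j).continuous_normed).locallyIntegrable
  have hfd : ∀ j x, fderiv ℝ (v j) x =
      convolution ((φ j).normed μ) (fderiv ℝ w) (ContinuousLinearMap.lsmul ℝ ℝ) μ x := by
    intro j x
    rw [← precompR_lsmul]
    exact (hc.hasFDerivAt_convolution_right L (hloc j) hw x).fderiv
  obtain ⟨B₁, hB₁⟩ := hw.continuous.bounded_above_of_compact_support hc
  obtain ⟨B₂, hB₂⟩ := hdcont.bounded_above_of_compact_support (hc.fderiv ℝ)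
  refine ⟨v, max B₁ B₂, fun j => ?_, fun j => ?_, fun j => ?_, fun j x => ?_, fun j x => ?_,
    fun x => ?_, fun x => ?_⟩
  · exact (φ j).hasCompactSupport_normed.contDiff_convolution_left L (φ j).contDiff_normed
      hw.continuous.locallyIntegrable
  · exact (φ j).hasCompactSupport_normed.convolution L hc
  · refine Subset.trans ?_ hδΩ
    refine closure_minimal ?_ isClosed_cthickening
    refine (support_convolution_subset L).trans ?_
    rintro _ ⟨y, hy, z, hz, rfl⟩
    rw [(φ j).support_normed_eq, mem_ball_zero_iff] at hy
    refine mem_cthickening_of_dist_le _ z _ _ (subset_tsupport w hz) ?_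
    simpa using hy.le.trans (hφδ j)
  · exact (norm_normed_convolution_le (φ j) hw.continuous hB₁ x).trans (le_max_left _ _)
  · rw [hfd]
    exact (norm_normed_convolution_le (φ j) hdcont hB₂ x).trans (le_max_right _ _)
  · exact ContDiffBump.convolution_tendsto_right_of_continuous hφ hw.continuous x
  · simp_rw [hfd]
    exact ContDiffBump.convolution_tendsto_right_of_continuous hφ hdcont x

theorem norm_gradient_eq_norm_fderiv {n : ℕ} (w : EuclideanSpace ℝ (Fin n) → ℝ)
    (x : EuclideanSpace ℝ (Fin n)) : ‖gradient w x‖ = ‖fderiv ℝ w x‖ := by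
  simp [gradient]

theorem sum_apply_single_sq {n : ℕ} (A : EuclideanSpace ℝ (Fin n) →L[ℝ] ℝ) :
    ∑ i, A (EuclideanSpace.single i 1) ^ 2 = ‖A‖ ^ 2 := by
  set y := (InnerProductSpace.toDual ℝ (EuclideanSpace ℝ (Fin n))).symm A with hy
  have hA : A = InnerProductSpace.toDual ℝ _ y := by simp [hy]
  rw [hA, LinearIsometryEquiv.norm_map, EuclideanSpace.norm_sq_eq]
  simp [EuclideanSpace.inner_single_right]

theorem StableSol.integral_le {n : ℕ} {f' : ℝ → ℝ} {u : EuclideanSpace ℝ (Fin n) → ℝ}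
    {Ω : Set (EuclideanSpace ℝ (Fin n))} (h : StableSol f' u Ω) (hΩ : IsOpen Ω)
    (hb : IsBounded Ω) (hf' : Continuous f') (hu : Continuous u)
    {w : EuclideanSpace ℝ (Fin n) → ℝ} (hw : ContDiff ℝ 1 w) (hs : tsupport w ⊆ Ω) :
    ∫ x in Ω, f' (u x) * w x ^ 2 ≤ ∫ x in Ω, ‖fderiv ℝ w x‖ ^ 2 := by
  have hc : HasCompactSupport w :=
    Metric.isCompact_of_isClosed_isBounded (isClosed_tsupport w) (hb.subset hs)
  have hfu : Continuous fun x => f' (u x) := hf'.comp hu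
  have hint : ∀ {g : EuclideanSpace ℝ (Fin n) → ℝ}, Continuous g → IntegrableOn g Ω := fun hg =>
    (hg.continuousOn.integrableOn_compact hb.isCompact_closure).mono_set subset_closure
  obtain ⟨v, B, hv, hvc, hvs, hvB, hdvB, hlim, hdlim⟩ := exists_smooth_approx hΩ hw hc hs
  have hlim' : Tendsto (fun j => ∫ x in Ω, (‖gradient (v j) x‖ ^ 2 - f' (u x) * v j x ^ 2)) atTop
      (𝓝 (∫ x in Ω, (‖fderiv ℝ w x‖ ^ 2 - f' (u x) * w x ^ 2))) := by
    simp_rw [norm_gradient_eq_norm_fderiv]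
    refine tendsto_integral_of_dominated_convergence (fun x => B ^ 2 + |f' (u x)| * B ^ 2)
      (fun j => ?_) (hint (by fun_prop)) (fun j => Eventually.of_forall fun x => ?_)
      (Eventually.of_forall fun x => ?_)
    · have h1 : Continuous (fderiv ℝ (v j)) := (hv j).continuous_fderiv (by simp)
      have h2 : Continuous (v j) := (hv j).continuous
      exact Continuous.aestronglyMeasurable (by fun_prop)
    · refine (norm_sub_le _ _).trans (add_le_add ?_ ?_)
      · rw [norm_pow, norm_norm]
        gcongr
        exact hdvB j x
      · rw [norm_mul, norm_pow, Real.norm_eq_abs, Real.norm_eq_abs]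
        gcongr
        exact hvB j x
    · exact ((hdlim x).norm.pow 2).sub (((hlim x).pow 2).const_mul _)
  have h0 : 0 ≤ ∫ x in Ω, (‖fderiv ℝ w x‖ ^ 2 - f' (u x) * w x ^ 2) :=
    ge_of_tendsto' hlim' fun j => h (v j) (hv j) (hvc j) (hvs j)
  have hd : Continuous (fderiv ℝ w) := hw.continuous_fderiv one_ne_zero
  have hw0 : Continuous w := hw.continuous
  rw [integral_sub (hint (by fun_prop)) (hint (by fun_prop))] at h0
  linarith

section Truncated

variable {n : ℕ} {u : EuclideanSpace ℝ (Fin n) → ℝ} {Ω : Set (EuclideanSpace ℝ (Fin n))}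
  {ε : ℝ}

theorem tsupport_comp_mul_subset (hu : Continuous u) (hu0 : ∀ x ∉ Ω, u x = 0) (hε : 0 < ε)
    {ψ : ℝ → ℝ} (hψ0 : ∀ t ≤ ε, ψ t = 0) (z : EuclideanSpace ℝ (Fin n) → ℝ) :
    tsupport (fun x => ψ (u x) * z x) ⊆ Ω := by
  have h1 : tsupport (fun x => ψ (u x) * z x) ⊆ {x | ε ≤ u x} := by
    refine closure_minimal (fun x hx => ?_) (isClosed_le continuous_const hu)
    by_contra hlt
    exact hx (by simp [hψ0 (u x) (not_le.1 hlt).le])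
  refine h1.trans fun x hx => ?_
  by_contra hxΩ
  have : ε ≤ u x := hx
  rw [hu0 x hxΩ] at this
  linarith

theorem contDiff_comp_mul (hΩ : IsOpen Ω) (hu : Continuous u) (hu0 : ∀ x ∉ Ω, u x = 0)
    (hu1 : ContDiffOn ℝ 1 u Ω) (hε : 0 < ε) {ψ : ℝ → ℝ} (hψ : ContDiff ℝ 1 ψ)
    (hψ0 : ∀ t ≤ ε, ψ t = 0) {z : EuclideanSpace ℝ (Fin n) → ℝ} (hz : ContDiffOn ℝ 1 z Ω) :
    ContDiff ℝ 1 (fun x => ψ (u x) * z x) := by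
  refine contDiff_iff_contDiffAt.2 fun x => ?_
  by_cases hx : x ∈ Ω
  · have hxn := hΩ.mem_nhds hx
    exact (hψ.contDiffAt.comp x (hu1.contDiffAt hxn)).mul (hz.contDiffAt hxn)
  · refine (contDiffAt_const (c := (0 : ℝ))).congr_of_eventuallyEq ?_
    have : ∀ᶠ y in 𝓝 x, u y < ε := hu.continuousAt.eventually_lt_const (by rwa [hu0 x hx])
    filter_upwards [this] with y hy
    simp [hψ0 (u y) hy.le]

theorem integral_fderiv_apply_eq_zero {E : Type*} [NormedAddCommGroup E] [NormedSpace ℝ E]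
    [FiniteDimensional ℝ E] [MeasurableSpace E] [BorelSpace E] {μ : Measure E}
    [μ.IsAddHaarMeasure] {w : E → ℝ}
    (hw : ContDiff ℝ 1 w) (hc : HasCompactSupport w) (e : E) : ∫ x, fderiv ℝ w x e ∂μ = 0 := by
  have hd : Integrable (fun x => fderiv ℝ w x e) μ :=
    ((hw.continuous_fderiv one_ne_zero).clm_apply continuous_const).integrable_of_hasCompactSupport
      (hc.fderiv_apply ℝ e)
  have := integral_mul_fderiv_eq_neg_fderiv_mul_of_integrable (μ := μ) (f := fun _ : E => (1 : ℝ))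
    (g := w) (v := e) (by simp) (by simpa using hd)
    (by simpa using hw.continuous.integrable_of_hasCompactSupport hc)
    (fun x _ => by fun_prop) (fun x _ => hw.differentiable one_ne_zero x)
  simpa using this

theorem integral_norm_fderiv_comp_sq (hΩ : IsOpen Ω) (hb : IsBounded Ω) (hu : Continuous u)
    (hu0 : ∀ x ∉ Ω, u x = 0) (hu2 : ContDiffOn ℝ 2 u Ω) {F : ℝ → ℝ} (hF : Continuous F)
    (hlap : ∀ x ∈ Ω, -lap u x = F (u x)) (hε : 0 < ε) {k G H : ℝ → ℝ} (hk : Continuous k)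
    (hG : ∀ t, HasDerivAt G (k t) t) (hG0 : ∀ t ≤ ε, G t = 0)
    (hH : ∀ t, HasDerivAt H (k t ^ 2) t) (hH0 : ∀ t ≤ ε, H t = 0) :
    ∫ x in Ω, ‖fderiv ℝ (fun y => G (u y)) x‖ ^ 2 = ∫ x in Ω, F (u x) * H (u x) := by
  have hint : ∀ {g : EuclideanSpace ℝ (Fin n) → ℝ}, Continuous g → IntegrableOn g Ω := fun hg =>
    (hg.continuousOn.integrableOn_compact hb.isCompact_closure).mono_set subset_closure
  have hu1 : ContDiffOn ℝ 1 u Ω := hu2.of_le one_le_two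
  have hGc : ContDiff ℝ 1 G := contDiff_one_iff_deriv.2
    ⟨fun t => (hG t).differentiableAt, by simpa [funext fun t => (hG t).deriv] using hk⟩
  have hHc : ContDiff ℝ 1 H := contDiff_one_iff_deriv.2
    ⟨fun t => (hH t).differentiableAt, by
      rw [funext fun t => (hH t).deriv]
      fun_prop⟩
  have hGu : ContDiff ℝ 1 fun y => G (u y) := by
    simpa using contDiff_comp_mul hΩ hu hu0 hu1 hε hGc hG0 (z := fun _ => 1) contDiffOn_const
  let z : Fin n → EuclideanSpace ℝ (Fin n) → ℝ := fun i y =>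
    fderiv ℝ u y (EuclideanSpace.single i 1)
  have hz : ∀ i, ContDiffOn ℝ 1 (z i) Ω := fun i =>
    (hu2.fderiv_of_isOpen hΩ (by norm_num)).clm_apply contDiffOn_const
  let W : Fin n → EuclideanSpace ℝ (Fin n) → ℝ := fun i y => H (u y) * z i y
  have hW : ∀ i, ContDiff ℝ 1 (W i) := fun i => contDiff_comp_mul hΩ hu hu0 hu1 hε hHc hH0 (hz i)
  have hWs : ∀ i, tsupport (W i) ⊆ Ω := fun i => tsupport_comp_mul_subset hu hu0 hε hH0 (z i)
  have hWc : ∀ i, HasCompactSupport (W i) := fun i =>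
    Metric.isCompact_of_isClosed_isBounded (isClosed_tsupport _) (hb.subset (hWs i))
  have hdW : ∀ i, Continuous fun x => fderiv ℝ (W i) x (EuclideanSpace.single i 1) := fun i =>
    ((hW i).continuous_fderiv one_ne_zero).clm_apply continuous_const
  have hpt : ∀ x ∈ Ω, ∑ i, fderiv ℝ (W i) x (EuclideanSpace.single i 1) =
      ‖fderiv ℝ (fun y => G (u y)) x‖ ^ 2 - F (u x) * H (u x) := by
    intro x hx
    have hxn := hΩ.mem_nhds hx
    have hud : HasFDerivAt u (fderiv ℝ u x) x :=
      ((hu1.contDiffAt hxn).differentiableAt one_ne_zero).hasFDerivAt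
    have hG' : fderiv ℝ (fun y => G (u y)) x = k (u x) • fderiv ℝ u x :=
      ((hG (u x)).comp_hasFDerivAt x hud).fderiv
    have hW' : ∀ i, fderiv ℝ (W i) x (EuclideanSpace.single i 1) =
        H (u x) * fderiv ℝ (z i) x (EuclideanSpace.single i 1) +
          k (u x) ^ 2 * fderiv ℝ u x (EuclideanSpace.single i 1) ^ 2 := by
      intro i
      have hzd := (((hz i).contDiffAt hxn).differentiableAt one_ne_zero).hasFDerivAt
      have : HasFDerivAt (W i) _ x := ((hH (u x)).comp_hasFDerivAt x hud).mul hzd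
      rw [this.fderiv]
      simp [z]
      ring
    have hl : lap u x = -F (u x) := by rw [← hlap x hx]; ring
    simp_rw [hW']
    rw [Finset.sum_add_distrib, ← Finset.mul_sum, ← Finset.mul_sum, sum_apply_single_sq, hG',
      norm_smul, mul_pow, Real.norm_eq_abs, sq_abs]
    change H (u x) * lap u x + _ = _
    rw [hl]
    ring
  have h0 : ∫ x in Ω, ∑ i, fderiv ℝ (W i) x (EuclideanSpace.single i 1) = 0 := by
    rw [integral_finsetSum _ fun i _ => hint (hdW i)]
    refine Finset.sum_eq_zero fun i _ => ?_
    rw [setIntegral_eq_integral_of_forall_compl_eq_zero, integral_fderiv_apply_eq_zero (hW i) (hWc i)]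
    intro x hx
    have : fderiv ℝ (W i) x = 0 := by
      by_contra hne
      exact hx (hWs i (support_fderiv_subset ℝ hne))
    simp [this]
  have hGd := hGu.continuous_fderiv one_ne_zero
  have hH1 : Continuous H := hHc.continuous
  rw [setIntegral_congr_fun hΩ.measurableSet hpt, integral_sub
    (hint (by fun_prop)) (hint (by fun_prop))] at h0
  linarith

end Truncated

/-- A nonnegative classical solution of `-Δu = F(u)` in the bounded open set `Ω`, extended by zero
to a continuous function on the whole space. -/
structure IsDirichletSol {n : ℕ} (F : ℝ → ℝ) (u : EuclideanSpace ℝ (Fin n) → ℝ)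
    (Ω : Set (EuclideanSpace ℝ (Fin n))) : Prop where
  isOpen : IsOpen Ω
  isBounded : IsBounded Ω
  continuous : Continuous u
  eq_zero : ∀ x ∉ Ω, u x = 0
  contDiffOn : ContDiffOn ℝ 2 u Ω
  neg_lap_eq : ∀ x ∈ Ω, -lap u x = F (u x)
  nonneg : ∀ x, 0 ≤ u x

theorem Continuous.integrableOn_of_isBounded {n : ℕ} {g : EuclideanSpace ℝ (Fin n) → ℝ}
    (hg : Continuous g) {Ω : Set (EuclideanSpace ℝ (Fin n))} (hΩ : IsBounded Ω) :
    IntegrableOn g Ω :=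
  (hg.continuousOn.integrableOn_compact hΩ.isCompact_closure).mono_set subset_closure

theorem Continuous.hasDerivAt_primitive {k : ℝ → ℝ} (hk : Continuous k) (t : ℝ) :
    HasDerivAt (fun t => ∫ s in (0 : ℝ)..t, k s) (k t) t :=
  intervalIntegral.integral_hasDerivAt_right (hk.intervalIntegrable _ _)
    (hk.stronglyMeasurableAtFilter _ _) hk.continuousAt

theorem Continuous.continuous_primitive_zero {k : ℝ → ℝ} (hk : Continuous k) :
    Continuous (fun t => ∫ s in (0 : ℝ)..t, k s) :=
  continuous_iff_continuousAt.2 fun t => (hk.hasDerivAt_primitive t).continuousAt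

namespace IsDirichletSol

variable {n : ℕ} {u : EuclideanSpace ℝ (Fin n) → ℝ} {Ω : Set (EuclideanSpace ℝ (Fin n))}
  {F : ℝ → ℝ}

theorem exists_approx (h : IsDirichletSol F u Ω) (hF : Continuous F) (hF0 : ∀ t, 0 ≤ F t)
    {k : ℝ → ℝ} (hk : Continuous k) (hk0 : ∀ t, 0 ≤ k t) :
    ∃ w : ℕ → EuclideanSpace ℝ (Fin n) → ℝ, (∀ j, ContDiff ℝ 1 (w j)) ∧
      (∀ j, tsupport (w j) ⊆ Ω) ∧
      (∀ j, ∫ x in Ω, ‖fderiv ℝ (w j) x‖ ^ 2 ≤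
        ∫ x in Ω, F (u x) * ∫ s in (0 : ℝ)..u x, k s ^ 2) ∧
      (∀ j x, 0 ≤ w j x ∧ w j x ≤ ∫ s in (0 : ℝ)..u x, k s) ∧
      ∀ x, Tendsto (fun j => w j x) atTop (𝓝 (∫ s in (0 : ℝ)..u x, k s)) := by
  let ε : ℕ → ℝ := fun j => 1 / ((j : ℝ) + 1)
  have hε : ∀ j, 0 < ε j := fun j => by positivity
  let χ : ℕ → ℝ → ℝ := fun j t => max 0 (min 1 (t / ε j - 1))
  have hχc : ∀ j, Continuous (χ j) := fun j => by fun_prop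
  have hχ0 : ∀ j t, 0 ≤ χ j t := fun j t => le_max_left _ _
  have hχ1 : ∀ j t, χ j t ≤ 1 := fun j t => max_le zero_le_one (min_le_left _ _)
  have hχε : ∀ j, ∀ t ≤ ε j, χ j t = 0 := fun j t ht => by
    refine max_eq_left ((min_le_right _ _).trans ?_)
    rw [sub_nonpos, div_le_one (hε j)]
    exact ht
  let κ : ℕ → ℝ → ℝ := fun j t => k t * χ j t
  have hκc : ∀ j, Continuous (κ j) := fun j => hk.mul (hχc j)
  have hκ0 : ∀ j t, 0 ≤ κ j t := fun j t => mul_nonneg (hk0 t) (hχ0 j t)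
  have hκk : ∀ j t, κ j t ≤ k t := fun j t => mul_le_of_le_one_right (hk0 t) (hχ1 j t)
  have hzero : ∀ j, ∀ t ≤ ε j, ∀ s ∈ uIcc 0 t, κ j s = 0 := fun j t ht s hs => by
    have : s ≤ ε j := hs.2.trans (max_le (hε j).le ht)
    simp [κ, hχε j s this]
  have hG0 : ∀ j, ∀ t ≤ ε j, ∫ s in (0 : ℝ)..t, κ j s = 0 := fun j t ht => by
    rw [intervalIntegral.integral_congr (g := fun _ => (0 : ℝ)) (hzero j t ht)]
    simp
  have hH0 : ∀ j, ∀ t ≤ ε j, ∫ s in (0 : ℝ)..t, κ j s ^ 2 = 0 := fun j t ht => by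
    rw [intervalIntegral.integral_congr (g := fun _ => (0 : ℝ))
      fun s hs => by simp [hzero j t ht s hs]]
    simp
  have hG : ∀ j t, HasDerivAt (fun t => ∫ s in (0 : ℝ)..t, κ j s) (κ j t) t :=
    fun j => (hκc j).hasDerivAt_primitive
  have hκ2 : ∀ j, Continuous fun s => κ j s ^ 2 := fun j => (hκc j).pow 2
  have hk2 : Continuous fun s => k s ^ 2 := hk.pow 2
  have hGc : ∀ j, ContDiff ℝ 1 (fun t => ∫ s in (0 : ℝ)..t, κ j s) := fun j =>
    contDiff_one_iff_deriv.2 ⟨fun t => (hG j t).differentiableAt, by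
      rw [funext fun t => (hG j t).deriv]
      exact hκc j⟩
  have hu1 : ContDiffOn ℝ 1 u Ω := h.contDiffOn.of_le one_le_two
  refine ⟨fun j x => ∫ s in (0 : ℝ)..u x, κ j s, fun j => ?_, fun j => ?_, fun j => ?_,
    fun j x => ⟨?_, ?_⟩, fun x => ?_⟩
  · simpa using contDiff_comp_mul h.isOpen h.continuous h.eq_zero hu1 (hε j) (hGc j) (hG0 j)
      (z := fun _ => 1) contDiffOn_const
  · simpa using tsupport_comp_mul_subset h.continuous h.eq_zero (hε j) (hG0 j) (fun _ => 1)
  · rw [integral_norm_fderiv_comp_sq h.isOpen h.isBounded h.continuous h.eq_zero h.contDiffOn hF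
      h.neg_lap_eq (hε j) (hκc j) (hG j) (hG0 j) (hκ2 j).hasDerivAt_primitive (hH0 j)]
    refine setIntegral_mono
      (((hF.comp h.continuous).mul ((hκ2 j).continuous_primitive_zero.comp
        h.continuous)).integrableOn_of_isBounded h.isBounded)
      (((hF.comp h.continuous).mul (hk2.continuous_primitive_zero.comp
        h.continuous)).integrableOn_of_isBounded h.isBounded) fun x => ?_
    refine mul_le_mul_of_nonneg_left ?_ (hF0 _)
    refine intervalIntegral.integral_mono (h.nonneg x) ((hκ2 j).intervalIntegrable _ _)
      (hk2.intervalIntegrable _ _) fun s => ?_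
    have := hκ0 j s
    have := hκk j s
    gcongr
  · exact intervalIntegral.integral_nonneg (h.nonneg x) fun s _ => hκ0 j s
  · exact intervalIntegral.integral_mono (h.nonneg x) ((hκc j).intervalIntegrable _ _)
      (hk.intervalIntegrable _ _) (hκk j)
  · refine intervalIntegral.tendsto_integral_filter_of_dominated_convergence k
      (Eventually.of_forall fun j => (hκc j).aestronglyMeasurable)
      (Eventually.of_forall fun j => Eventually.of_forall fun s _ => ?_)
      (hk.intervalIntegrable _ _) (Eventually.of_forall fun s hs => ?_)
    · rw [Real.norm_eq_abs, abs_of_nonneg (hκ0 j s)]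
      exact hκk j s
    · rw [uIoc_of_le (h.nonneg x)] at hs
      have hev : ∀ᶠ j in atTop, ε j < s / 2 :=
        tendsto_one_div_add_atTop_nhds_zero_nat.eventually_lt_const (half_pos hs.1)
      refine tendsto_const_nhds.congr' ?_
      filter_upwards [hev] with j hj
      have h2 : 1 ≤ s / ε j - 1 := by
        rw [le_sub_iff_add_le, le_div_iff₀ (hε j)]
        linarith
      simp [κ, χ, min_eq_left h2]

theorem integral_stable_le (h : IsDirichletSol F u Ω) (hF : Continuous F) (hF0 : ∀ t, 0 ≤ F t)
    {φ : ℝ → ℝ} (hφ : Continuous φ) (hst : StableSol φ u Ω)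
    {k : ℝ → ℝ} (hk : Continuous k) (hk0 : ∀ t, 0 ≤ k t) :
    ∫ x in Ω, φ (u x) * (∫ s in (0 : ℝ)..u x, k s) ^ 2 ≤
      ∫ x in Ω, F (u x) * ∫ s in (0 : ℝ)..u x, k s ^ 2 := by
  obtain ⟨w, hw, hws, hwi, hwb, hwt⟩ := h.exists_approx hF hF0 hk hk0
  have hφu : Continuous fun x => φ (u x) := hφ.comp h.continuous
  have hGu : Continuous fun x => ∫ s in (0 : ℝ)..u x, k s :=
    hk.continuous_primitive_zero.comp h.continuous
  have hbound : Continuous fun x => |φ (u x)| * (∫ s in (0 : ℝ)..u x, k s) ^ 2 :=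
    hφu.abs.mul (hGu.pow 2)
  have hlim : Tendsto (fun j => ∫ x in Ω, φ (u x) * w j x ^ 2) atTop
      (𝓝 (∫ x in Ω, φ (u x) * (∫ s in (0 : ℝ)..u x, k s) ^ 2)) := by
    refine tendsto_integral_of_dominated_convergence
      (fun x => |φ (u x)| * (∫ s in (0 : ℝ)..u x, k s) ^ 2)
      (fun j => (hφu.mul ((hw j).continuous.pow 2)).aestronglyMeasurable)
      (hbound.integrableOn_of_isBounded h.isBounded)
      (fun j => Eventually.of_forall fun x => ?_)
      (Eventually.of_forall fun x => ((hwt x).pow 2).const_mul _)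
    rw [norm_mul, norm_pow, Real.norm_eq_abs, Real.norm_eq_abs, abs_of_nonneg (hwb j x).1]
    have := hwb j x
    gcongr
    exacts [this.1, this.2]
  exact le_of_tendsto' hlim fun j =>
    (hst.integral_le h.isOpen h.isBounded hφ h.continuous (hw j) (hws j)).trans (hwi j)

theorem integral_sobolev_le (h : IsDirichletSol F u Ω) (hF : Continuous F) (hF0 : ∀ t, 0 ≤ F t)
    {q C : ℝ} (hq : 0 < q) (hC0 : 0 ≤ C)
    (hC : ∀ w : EuclideanSpace ℝ (Fin n) → ℝ, ContDiff ℝ 1 w → tsupport w ⊆ Ω →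
      (∫ x, |w x| ^ q) ^ (2 / q) ≤ C * ∫ x, ‖fderiv ℝ w x‖ ^ 2)
    {k : ℝ → ℝ} (hk : Continuous k) (hk0 : ∀ t, 0 ≤ k t) :
    (∫ x in Ω, (∫ s in (0 : ℝ)..u x, k s) ^ q) ^ (2 / q) ≤
      C * ∫ x in Ω, F (u x) * ∫ s in (0 : ℝ)..u x, k s ^ 2 := by
  obtain ⟨w, hw, hws, hwi, hwb, hwt⟩ := h.exists_approx hF hF0 hk hk0
  have hGu := hk.continuous_primitive_zero.comp h.continuous
  have hlim : Tendsto (fun j => ∫ x in Ω, |w j x| ^ q) atTop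
      (𝓝 (∫ x in Ω, (∫ s in (0 : ℝ)..u x, k s) ^ q)) := by
    refine tendsto_integral_of_dominated_convergence (fun x => (∫ s in (0 : ℝ)..u x, k s) ^ q)
      (fun j => ((hw j).continuous.abs.rpow_const fun _ => Or.inr hq.le).aestronglyMeasurable)
      ((hGu.rpow_const fun _ => Or.inr hq.le).integrableOn_of_isBounded h.isBounded)
      (fun j => Eventually.of_forall fun x => ?_) (Eventually.of_forall fun x => ?_)
    · rw [abs_of_nonneg (hwb j x).1, Real.norm_eq_abs,
        abs_of_nonneg (Real.rpow_nonneg (hwb j x).1 q)]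
      exact Real.rpow_le_rpow (hwb j x).1 (hwb j x).2 hq.le
    · simp_rw [abs_of_nonneg (hwb _ x).1]
      exact (hwt x).rpow_const (Or.inr hq.le)
  refine le_of_tendsto' (hlim.rpow_const (Or.inr (by positivity))) fun j => ?_
  have hsub : ∀ x ∉ Ω, w j x = 0 := fun x hx => by
    by_contra hne
    exact hx (hws j (subset_tsupport _ hne))
  have hsub' : ∀ x ∉ Ω, fderiv ℝ (w j) x = 0 := fun x hx => by
    by_contra hne
    exact hx (hws j (support_fderiv_subset ℝ hne))
  rw [setIntegral_eq_integral_of_forall_compl_eq_zero fun x hx => by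
    simp [hsub x hx, Real.zero_rpow hq.ne']]
  refine (hC (w j) (hw j) (hws j)).trans (mul_le_mul_of_nonneg_left ?_ hC0)
  rw [← setIntegral_eq_integral_of_forall_compl_eq_zero (s := Ω) fun x hx => by
    simp [hsub' x hx]]
  exact hwi j

end IsDirichletSol

namespace C2On01

variable {f f' f'' : ℝ → ℝ} {t : ℝ}

theorem hasDerivAt (h : C2On01 f f' f'') (ht : t ∈ Ioo (0 : ℝ) 1) : HasDerivAt f (f' t) t :=
  (h.1 t (Ioo_subset_Ico_self ht)).hasDerivAt (Ico_mem_nhds ht.1 ht.2)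

theorem hasDerivAt_deriv (h : C2On01 f f' f'') (ht : t ∈ Ioo (0 : ℝ) 1) :
    HasDerivAt f' (f'' t) t :=
  (h.2.1 t (Ioo_subset_Ico_self ht)).hasDerivAt (Ico_mem_nhds ht.1 ht.2)

theorem continuousOn (h : C2On01 f f' f'') : ContinuousOn f (Ico 0 1) :=
  fun t ht => (h.1 t ht).continuousWithinAt

theorem continuousOn_deriv (h : C2On01 f f' f'') : ContinuousOn f' (Ico 0 1) :=
  fun t ht => (h.2.1 t ht).continuousWithinAt

theorem monotoneOn (h : C2On01 f f' f'') (hf' : ∀ t ∈ Ico (0 : ℝ) 1, 0 ≤ f' t) :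
    MonotoneOn f (Ico 0 1) :=
  monotoneOn_of_hasDerivWithinAt_nonneg (convex_Ico 0 1) h.continuousOn
    (fun t ht => (h.1 t (interior_subset ht)).mono interior_subset)
    fun t ht => hf' t (interior_subset ht)

theorem monotoneOn_deriv (h : C2On01 f f' f'') (hf'' : ∀ t ∈ Ico (0 : ℝ) 1, 0 ≤ f'' t) :
    MonotoneOn f' (Ico 0 1) :=
  monotoneOn_of_hasDerivWithinAt_nonneg (convex_Ico 0 1) h.continuousOn_deriv
    (fun t ht => (h.2.1 t (interior_subset ht)).mono interior_subset)
    fun t ht => hf'' t (interior_subset ht)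

theorem sub_nonneg (h : C2On01 f f' f'') (hf' : ∀ t ∈ Ico (0 : ℝ) 1, 0 ≤ f' t)
    (ht : t ∈ Ico (0 : ℝ) 1) : 0 ≤ f t - f 0 :=
  _root_.sub_nonneg.2 (h.monotoneOn hf' (by norm_num) ht ht.1)

theorem sub_le_deriv_mul (h : C2On01 f f' f'') (hf'' : ∀ t ∈ Ico (0 : ℝ) 1, 0 ≤ f'' t)
    (ht : t ∈ Ico (0 : ℝ) 1) : f t - f 0 ≤ f' t * t := by
  rcases ht.1.eq_or_lt with rfl | h0
  · simp
  have hsub : Icc 0 t ⊆ Ico (0 : ℝ) 1 := Icc_subset_Ico_right ht.2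
  obtain ⟨c, hc, hcs⟩ := exists_hasDerivAt_eq_slope f f' h0 (h.continuousOn.mono hsub)
    fun s hs => h.hasDerivAt ⟨hs.1, hs.2.trans ht.2⟩
  have hle := h.monotoneOn_deriv hf'' (hsub (Ioo_subset_Icc_self hc)) ht hc.2.le
  rw [hcs, div_le_iff₀ (by linarith)] at hle
  simpa using hle

theorem integral_rpow_mul_deriv (h : C2On01 f f' f'')
    (ht : t ∈ Ico (0 : ℝ) 1) {a : ℝ} (ha : 1 ≤ a) :
    ∫ s in (0 : ℝ)..t, a * (f s - f 0) ^ (a - 1) * f' s = (f t - f 0) ^ a := by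
  have hsub : Icc 0 t ⊆ Ico (0 : ℝ) 1 := Icc_subset_Ico_right ht.2
  have hc : ContinuousOn (fun s => f s - f 0) (Icc 0 t) :=
    (h.continuousOn.mono hsub).sub continuousOn_const
  rw [intervalIntegral.integral_eq_sub_of_hasDerivAt_of_le ht.1
    (f := fun s => (f s - f 0) ^ a) (hc.rpow_const fun _ _ => Or.inr (by linarith))]
  · simp [Real.zero_rpow (show a ≠ 0 by linarith)]
  · intro s hs
    have := ((h.hasDerivAt ⟨hs.1, hs.2.trans ht.2⟩).sub_const (f 0)).rpow_const (p := a)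
      (Or.inr ha)
    rwa [mul_comm (f' s) a, mul_right_comm] at this
  · refine ContinuousOn.intervalIntegrable ?_
    rw [uIcc_of_le ht.1]
    exact (continuousOn_const.mul (hc.rpow_const fun _ _ => Or.inr (by linarith))).mul
      (h.continuousOn_deriv.mono hsub)

theorem integral_rpow_mul_deriv_sq_le (h : C2On01 f f' f'')
    (hf' : ∀ t ∈ Ico (0 : ℝ) 1, 0 ≤ f' t) {θ K' a : ℝ} (hθ : 0 < θ) (hK' : 0 ≤ K') (ha : 2 < a)
    (hf : ∀ t ∈ Ico (0 : ℝ) 1, (1 + θ) * f' t ^ 2 - K' ≤ f'' t * (f t - f 0))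
    (ht : t ∈ Ico (0 : ℝ) 1) :
    ∫ s in (0 : ℝ)..t, (a * (f s - f 0) ^ (a - 1) * f' s) ^ 2 ≤
      a ^ 2 / (2 * a + θ) *
        (f' t * (f t - f 0) ^ (2 * a - 1) + K' * (t * (f t - f 0) ^ (2 * a - 2))) := by
  have hsub : Icc 0 t ⊆ Ico (0 : ℝ) 1 := Icc_subset_Ico_right ht.2
  have hc : ContinuousOn (fun s => f s - f 0) (Icc 0 t) :=
    (h.continuousOn.mono hsub).sub continuousOn_const
  have hc' : ContinuousOn f' (Icc 0 t) := h.continuousOn_deriv.mono hsub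
  have hcp : ∀ p : ℝ, 0 ≤ p → ContinuousOn (fun s => (f s - f 0) ^ p) (Icc 0 t) := fun p hp =>
    hc.rpow_const fun _ _ => Or.inr hp
  have hden : 0 < 2 * a + θ := by linarith
  set c := a ^ 2 / (2 * a + θ) with hcdef
  have hc0 : 0 ≤ c := by positivity
  have hca : c * (2 * a + θ) = a ^ 2 := div_mul_cancel₀ _ hden.ne'
  have key := intervalIntegral.integral_le_sub_of_hasDeriv_right_of_le (a := 0) (b := t)
    (g := fun s => c * (f' s * (f s - f 0) ^ (2 * a - 1) + K' * (s * (f s - f 0) ^ (2 * a - 2))))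
    (g' := fun s => c * ((f'' s * (f s - f 0) ^ (2 * a - 1) +
      f' s * (f' s * (2 * a - 1) * (f s - f 0) ^ (2 * a - 1 - 1))) +
      K' * (1 * (f s - f 0) ^ (2 * a - 2) +
        s * (f' s * (2 * a - 2) * (f s - f 0) ^ (2 * a - 2 - 1)))))
    (φ := fun s => (a * (f s - f 0) ^ (a - 1) * f' s) ^ 2) ht.1 ?_ ?_ ?_ ?_
  · refine key.trans (le_of_eq ?_)
    simp [Real.zero_rpow (show 2 * a - 1 ≠ 0 by linarith)]
  · exact continuousOn_const.mul ((hc'.mul (hcp _ (by linarith))).add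
      (continuousOn_const.mul (continuousOn_id.mul (hcp _ (by linarith)))))
  · intro s hs
    have hs1 : s ∈ Ioo (0 : ℝ) 1 := ⟨hs.1, hs.2.trans ht.2⟩
    have hd := (h.hasDerivAt hs1).sub_const (f 0)
    exact ((((h.hasDerivAt_deriv hs1).mul (hd.rpow_const (Or.inr (by linarith)))).add
      (((hasDerivAt_id s).mul (hd.rpow_const (Or.inr (by linarith)))).const_mul K')).const_mul
        c).hasDerivWithinAt
  · exact (((continuousOn_const.mul (hcp _ (by linarith))).mul hc').pow 2).integrableOn_compact
      isCompact_Icc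
  · intro s hs
    have hs1 : s ∈ Ico (0 : ℝ) 1 := ⟨hs.1.le, hs.2.trans ht.2⟩
    have hy := h.sub_nonneg hf' hs1
    have hz := hf' s hs1
    have hfs := hf s hs1
    have hs0 : 0 ≤ s := hs1.1
    set y := f s - f 0
    have e1 : y ^ (2 * a - 1) = y * y ^ (2 * a - 2) := by
      rw [← Real.rpow_one_add' hy (by linarith)]
      congr 1
      ring
    have e2 : (y ^ (a - 1)) ^ 2 = y ^ (2 * a - 2) := by
      rw [← Real.rpow_natCast, ← Real.rpow_mul hy]
      congr 1
      push_cast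
      ring
    have e3 : (2 * a - 1 - 1) = 2 * a - 2 := by ring
    have hP : 0 ≤ y ^ (2 * a - 2) := Real.rpow_nonneg hy _
    have hQ : 0 ≤ K' * (s * (f' s * (2 * a - 2) * y ^ (2 * a - 2 - 1))) := by
      have := Real.rpow_nonneg hy (2 * a - 2 - 1)
      have : 0 ≤ 2 * a - 2 := by linarith
      positivity
    change (a * y ^ (a - 1) * f' s) ^ 2 ≤ _
    rw [mul_pow, mul_pow, e2, ← hca, e1, e3]
    have hmain : (2 * a + θ) * y ^ (2 * a - 2) * f' s ^ 2 ≤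
        (f'' s * (y * y ^ (2 * a - 2)) + f' s * (f' s * (2 * a - 1) * y ^ (2 * a - 2))) +
        K' * (1 * y ^ (2 * a - 2) + s * (f' s * (2 * a - 2) * y ^ (2 * a - 2 - 1))) := by
      nlinarith [mul_le_mul_of_nonneg_right hfs hP]
    calc c * (2 * a + θ) * y ^ (2 * a - 2) * f' s ^ 2
        = c * ((2 * a + θ) * y ^ (2 * a - 2) * f' s ^ 2) := by ring
      _ ≤ _ := mul_le_mul_of_nonneg_left hmain hc0

end C2On01

theorem mul_rpow_sub_one_le {x y ε m : ℝ} (hx : 0 ≤ x) (hy : 0 ≤ y) (hε : 0 < ε) (hm : 1 < m) :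
    x * y ^ (m - 1) ≤ ε * y ^ m + ε ^ (-(m - 1)) * x ^ m := by
  have hsplit : ∀ {z : ℝ}, 0 ≤ z → z ^ m = z * z ^ (m - 1) := fun hz => by
    rw [← Real.rpow_one_add' hz (by linarith)]
    congr 1
    ring
  have h1 : 0 ≤ y ^ m := Real.rpow_nonneg hy m
  have h2 : 0 ≤ x ^ m := Real.rpow_nonneg hx m
  have h3 : 0 ≤ ε ^ (-(m - 1)) := Real.rpow_nonneg hε.le _
  rcases le_total x (ε * y) with h | h
  · calc x * y ^ (m - 1) ≤ ε * y * y ^ (m - 1) :=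
          mul_le_mul_of_nonneg_right h (Real.rpow_nonneg hy _)
      _ = ε * y ^ m := by rw [hsplit hy]; ring
      _ ≤ _ := le_add_of_nonneg_right (by positivity)
  · have hyx : y ≤ ε⁻¹ * x := by rwa [inv_mul_eq_div, le_div_iff₀' hε]
    calc x * y ^ (m - 1) ≤ x * (ε⁻¹ * x) ^ (m - 1) := by
          have : 0 ≤ m - 1 := by linarith
          gcongr
      _ = ε ^ (-(m - 1)) * x ^ m := by
          rw [Real.mul_rpow (by positivity) hx, hsplit hx, Real.inv_rpow hε.le,
            Real.rpow_neg hε.le]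
          ring
      _ ≤ _ := le_add_of_nonneg_left (by positivity)

theorem rpow_le_interpolation {y s m P : ℝ} (hy : 0 ≤ y) (hs : 0 < s) (hm : 1 < m) (hP : m < P) :
    y ^ m ≤ s ^ (m - P) * y ^ P + s ^ (m - 1) * y := by
  rcases hy.eq_or_lt with rfl | hy0
  · simp [Real.zero_rpow (show m ≠ 0 by linarith), Real.zero_rpow (show P ≠ 0 by linarith)]
  rcases le_total s y with h | h
  · calc y ^ m = y ^ (m - P) * y ^ P := by rw [← Real.rpow_add hy0]; congr 1; ring
      _ ≤ s ^ (m - P) * y ^ P := by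
          have := Real.rpow_le_rpow_of_nonpos hs h (show m - P ≤ 0 by linarith)
          gcongr
      _ ≤ _ := le_add_of_nonneg_right (by positivity)
  · calc y ^ m = y ^ (m - 1) * y := by
          rw [← Real.rpow_add_one hy0.ne']; congr 1; ring
      _ ≤ s ^ (m - 1) * y := by
          have : 0 ≤ m - 1 := by linarith
          gcongr
      _ ≤ _ := le_add_of_nonneg_left (by positivity)

theorem exists_le_mul_of_forall_rpow_le {m P E₁ E₂ E₃ : ℝ} (hm : 1 < m) (hP : m < P)
    (hE₁ : 0 ≤ E₁) (hE₂ : 0 ≤ E₂) (hE₃ : 0 ≤ E₃) :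
    ∃ L : ℝ, 0 < L ∧ ∀ N R : ℝ, 0 ≤ N → 0 ≤ R →
      (∀ s > 0, N ^ m ≤ E₁ * R ^ m + E₂ * (s ^ (m - P) * N ^ P) + E₃ * (s ^ (m - 1) * R)) →
      N ≤ L * R := by
  set T := (4 * E₂ + 1) ^ (1 / (P - m)) with hTdef
  have hT : 0 < T := by positivity
  have hTm : T ^ (m - P) = (4 * E₂ + 1)⁻¹ := by
    rw [hTdef, ← Real.rpow_mul (by positivity), ← Real.rpow_neg_one]
    congr 1
    field_simp [show P - m ≠ 0 by linarith]
    ring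
  set B := T ^ (m - 1)
  have hB : 0 ≤ B := by positivity
  have hL : 1 ≤ 1 + 4 * E₁ + 4 * E₃ * B := by
    have : 0 ≤ E₃ * B := by positivity
    linarith
  refine ⟨1 + 4 * E₁ + 4 * E₃ * B, by linarith, fun N R hN hR h => ?_⟩
  set L := 1 + 4 * E₁ + 4 * E₃ * B with hLdef
  by_contra! hlt
  have hN0 : 0 < N := lt_of_le_of_lt (by positivity) hlt
  have hNm : 0 < N ^ m := by positivity
  have e1 : N ^ (m - 1) * N = N ^ m := by
    rw [← Real.rpow_add_one hN0.ne']
    congr 1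
    ring
  have e2 : N ^ (m - P) * N ^ P = N ^ m := by
    rw [← Real.rpow_add hN0]
    congr 1
    ring
  have hLR : L * R ^ m ≤ N ^ m := calc
    L * R ^ m ≤ L ^ m * R ^ m := by
      gcongr
      exact Real.self_le_rpow_of_one_le hL hm.le
    _ = (L * R) ^ m := (Real.mul_rpow (by linarith) hR).symm
    _ ≤ N ^ m := by gcongr
  have hLR' : L * (N ^ (m - 1) * R) ≤ N ^ m := calc
    L * (N ^ (m - 1) * R) = N ^ (m - 1) * (L * R) := by ring
    _ ≤ N ^ (m - 1) * N := by gcongr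
    _ = N ^ m := e1
  have key := h (T * N) (by positivity)
  rw [Real.mul_rpow hT.le hN, Real.mul_rpow hT.le hN, hTm, mul_assoc, mul_assoc, e2] at key
  have hR0 : 0 ≤ R ^ m := by positivity
  have hR1 : 0 ≤ N ^ (m - 1) * R := by positivity
  have t1 : 4 * (E₁ * R ^ m) ≤ N ^ m := by
    refine le_trans ?_ hLR
    rw [← mul_assoc]
    have : 0 ≤ E₃ * B := by positivity
    gcongr
    linarith
  have t3 : 4 * (E₃ * (B * (N ^ (m - 1) * R))) ≤ N ^ m := by
    refine le_trans ?_ hLR'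
    rw [← mul_assoc, ← mul_assoc]
    gcongr
    linarith
  have t2 : 4 * (E₂ * ((4 * E₂ + 1)⁻¹ * N ^ m)) ≤ N ^ m := by
    have : 4 * (E₂ * ((4 * E₂ + 1)⁻¹ * N ^ m)) = (4 * E₂) / (4 * E₂ + 1) * N ^ m := by
      field_simp
    rw [this]
    refine mul_le_of_le_one_left hNm.le ((div_le_one (by positivity)).2 (by linarith))
  linarith

/-- The bookkeeping of the absorption argument: the chain of integral inequalities satisfied by a
stable solution bounds the norm `N` linearly by `b + S`. -/
theorem exists_le_mul_of_absorption {m P κ K' c CS V : ℝ} (hm : 1 < m) (hP : m < P) (hκ : 0 ≤ κ)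
    (hκ1 : κ < 1) (hK' : 0 ≤ K') (hc : 0 ≤ c) (hCS : 0 ≤ CS) (hV : 0 ≤ V) :
    ∃ L : ℝ, 0 < L ∧ ∀ b S X Y W Z U U' Q N D : ℝ,
      0 ≤ b → 0 ≤ S → 0 ≤ U → 0 ≤ N → 0 ≤ D →
      N ^ m ≤ CS * D → X ≤ D → D ≤ κ * (Y + K' * W) → U ≤ c * U' →
      (∀ ε > 0, Y ≤ (1 + ε) * X + ε ^ (-(m - 1)) * (b ^ (m - 1) * S)) →
      W ≤ Q + U → (∀ ε > 0, U' ≤ ε * U + ε ^ (-(m - 1)) * Q) → Q ≤ 2 ^ m * (Z + V * b ^ m) →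
      (∀ δ > 0, ∀ s > 0, Z ≤ δ ^ m * U + (s ^ (m - P) * N ^ P + s ^ (m - 1) * (S / δ))) →
      N ≤ L * (b + S) := by
  obtain ⟨A₁, hA₁, hU⟩ : ∃ A₁ : ℝ, 0 ≤ A₁ ∧ ∀ U U' Q : ℝ, 0 ≤ U → U ≤ c * U' →
      (∀ ε > 0, U' ≤ ε * U + ε ^ (-(m - 1)) * Q) → U ≤ A₁ * Q := by
    refine ⟨2 * c * (1 / (2 * (c + 1))) ^ (-(m - 1)), by positivity, fun U U' Q hU0 hU hε => ?_⟩
    have h1 := hε (1 / (2 * (c + 1))) (by positivity)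
    have h2 : c * (1 / (2 * (c + 1))) ≤ 1 / 2 := by
      rw [mul_one_div, div_le_div_iff₀ (by positivity) (by norm_num)]
      linarith
    nlinarith [mul_le_mul_of_nonneg_left h1 hc, mul_le_mul_of_nonneg_right h2 hU0]
  obtain ⟨A₂, A₃, hA₂, hA₃, hD⟩ : ∃ A₂ A₃ : ℝ, 0 ≤ A₂ ∧ 0 ≤ A₃ ∧ ∀ X Y W D Q r B : ℝ,
      0 ≤ D → X ≤ D → D ≤ κ * (Y + K' * W) → W ≤ (1 + A₁) * Q → B ≤ r →
      (∀ ε > 0, Y ≤ (1 + ε) * X + ε ^ (-(m - 1)) * B) → D ≤ A₂ * r + A₃ * Q := by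
    set ε := (1 - κ) / 2 with hεdef
    have hε : 0 < ε := by linarith
    have hgap : κ * (1 + ε) ≤ 1 - ε := by nlinarith
    refine ⟨ε⁻¹ * (κ * ε ^ (-(m - 1))), ε⁻¹ * (κ * (K' * (1 + A₁))), by positivity, by positivity,
      fun X Y W D Q r B hD0 hX hD hW hB hY => ?_⟩
    have hY' := hY ε hε
    have hεp : 0 ≤ ε ^ (-(m - 1)) := by positivity
    have h1 : κ * (Y + K' * W) ≤
        κ * ((1 + ε) * D + ε ^ (-(m - 1)) * r + K' * ((1 + A₁) * Q)) := by
      gcongr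
      exact hY'.trans (by gcongr)
    have h2 : ε * D ≤ κ * (ε ^ (-(m - 1)) * r + K' * ((1 + A₁) * Q)) := by
      nlinarith [mul_le_mul_of_nonneg_right hgap hD0]
    calc D = ε⁻¹ * (ε * D) := by field_simp
      _ ≤ ε⁻¹ * (κ * (ε ^ (-(m - 1)) * r + K' * ((1 + A₁) * Q))) := by gcongr
      _ = _ := by ring
  have h2m : (0 : ℝ) < 2 ^ m := by positivity
  set δ := (1 / (2 * A₁ * 2 ^ m + 1)) ^ (1 / m) with hδdef
  have hδ : 0 < δ := by positivity
  have hδm : δ ^ m * (A₁ * 2 ^ m) ≤ 1 / 2 := by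
    rw [hδdef, ← Real.rpow_mul (by positivity), one_div_mul_cancel (by linarith), Real.rpow_one,
      div_mul_eq_mul_div, div_le_div_iff₀ (by positivity) (by norm_num)]
    linarith
  obtain ⟨L, hL, hmain⟩ := exists_le_mul_of_forall_rpow_le (m := m) (P := P)
    (E₁ := CS * (A₂ + A₃ * 2 ^ m * (2 * V))) (E₂ := CS * (A₃ * 2 ^ m * 2))
    (E₃ := CS * (A₃ * 2 ^ m * (2 * δ⁻¹))) hm hP (by positivity) (by positivity) (by positivity)
  refine ⟨L, hL, fun b S X Y W Z U U' Q N D hb hS hU0 hN hD0 hNm hX hDY hUU' hY hW hU' hQ hZ =>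
    hmain N (b + S) hN (by positivity) fun s hs => ?_⟩
  have hUQ := hU U U' Q hU0 hUU' hU'
  have hbm : b ^ m ≤ (b + S) ^ m := by
    gcongr
    linarith
  have hbS : b ^ (m - 1) * S ≤ (b + S) ^ m := calc
    b ^ (m - 1) * S ≤ (b + S) ^ (m - 1) * (b + S) := by
      have : 0 ≤ m - 1 := by linarith
      gcongr <;> linarith
    _ = (b + S) ^ m := by
      rw [mul_comm, ← Real.rpow_one_add' (by positivity) (by linarith)]
      congr 1
      ring
  have hDQ := hD X Y W D Q _ _ hD0 hX hDY (by linarith) hbS hY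
  set r := (b + S) ^ m
  have hQr : Q ≤ 2 ^ m * (Z + V * r) := hQ.trans (by gcongr)
  set M := s ^ (m - P) * N ^ P + s ^ (m - 1) * (S / δ) with hM
  have hZs : Z ≤ V * r + 2 * M := by
    have h1 : δ ^ m * U ≤ δ ^ m * (A₁ * (2 ^ m * (Z + V * r))) := by
      gcongr
      exact hUQ.trans (by gcongr)
    have h3 := hZ δ hδ s hs
    by_cases h0 : 0 ≤ Z + V * r
    · nlinarith [mul_le_mul_of_nonneg_right hδm h0]
    · have : 0 ≤ M := by positivity
      have : 0 ≤ r := by positivity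
      nlinarith [mul_nonneg hV this]
  have hMS : M ≤ s ^ (m - P) * N ^ P + s ^ (m - 1) * ((b + S) / δ) := by
    rw [hM]
    gcongr
    linarith
  calc N ^ m ≤ CS * D := hNm
    _ ≤ CS * (A₂ * r + A₃ * (2 ^ m * (V * r +
        2 * (s ^ (m - P) * N ^ P + s ^ (m - 1) * ((b + S) / δ)) + V * r))) := by
      gcongr
      refine hDQ.trans ?_
      gcongr
      refine hQr.trans ?_
      gcongr
      linarith
    _ = _ := by
      rw [div_eq_mul_inv]
      ring

theorem add_rpow_le_two_rpow_mul {x y m : ℝ} (hx : 0 ≤ x) (hy : 0 ≤ y) (hm : 0 ≤ m) :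
    (x + y) ^ m ≤ 2 ^ m * x ^ m + 2 ^ m * y ^ m := by
  have h1 : 0 ≤ x ^ m := Real.rpow_nonneg hx m
  have h2 : 0 ≤ y ^ m := Real.rpow_nonneg hy m
  rcases le_total x y with h | h
  · calc (x + y) ^ m ≤ (2 * y) ^ m := by
          gcongr
          linarith
      _ = 2 ^ m * y ^ m := Real.mul_rpow zero_le_two hy
      _ ≤ _ := le_add_of_nonneg_left (by positivity)
  · calc (x + y) ^ m ≤ (2 * x) ^ m := by
          gcongr
          linarith
      _ = 2 ^ m * x ^ m := Real.mul_rpow zero_le_two hx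
      _ ≤ _ := le_add_of_nonneg_right (by positivity)

theorem setIntegral_le_const_mul_add {n : ℕ} {Ω : Set (EuclideanSpace ℝ (Fin n))}
    (hΩ : IsBounded Ω) {g A B : EuclideanSpace ℝ (Fin n) → ℝ} {α β : ℝ} (hg : Continuous g)
    (hA : Continuous A) (hB : Continuous B) (h : ∀ x, g x ≤ α * A x + β * B x) :
    ∫ x in Ω, g x ≤ α * (∫ x in Ω, A x) + β * ∫ x in Ω, B x := by
  have hA' : IntegrableOn (fun x => α * A x) Ω :=
    (continuous_const.mul hA).integrableOn_of_isBounded hΩ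
  have hB' : IntegrableOn (fun x => β * B x) Ω :=
    (continuous_const.mul hB).integrableOn_of_isBounded hΩ
  rw [← integral_const_mul, ← integral_const_mul, ← integral_add hA' hB']
  exact integral_mono (hg.integrableOn_of_isBounded hΩ) (hA'.add hB') h

theorem integral_mul_rpow_sub_one {a t : ℝ} (ha : 1 ≤ a) (ht : 0 ≤ t) :
    ∫ s in (0 : ℝ)..t, a * max 0 s ^ (a - 1) = t ^ a := by
  rw [intervalIntegral.integral_congr (g := fun s => a * s ^ (a - 1)) fun s hs => by
      rw [uIcc_of_le ht] at hs
      simp [max_eq_right hs.1],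
    intervalIntegral.integral_const_mul, integral_rpow (Or.inl (by linarith)), sub_add_cancel,
    Real.zero_rpow (by linarith)]
  field_simp
  ring

theorem integral_sq_mul_rpow_sub_one {a t : ℝ} (ha : 1 ≤ a) (ht : 0 ≤ t) :
    ∫ s in (0 : ℝ)..t, (a * max 0 s ^ (a - 1)) ^ 2 =
      a ^ 2 / (2 * a - 1) * t ^ (2 * a - 1) := by
  rw [intervalIntegral.integral_congr (g := fun s => a ^ 2 * s ^ (2 * a - 2)) fun s hs => by
      rw [uIcc_of_le ht] at hs
      simp only [max_eq_right hs.1]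
      rw [mul_pow, ← Real.rpow_mul_natCast hs.1]
      congr 2
      push_cast
      ring,
    intervalIntegral.integral_const_mul, integral_rpow (Or.inl (by linarith)),
    show 2 * a - 2 + 1 = 2 * a - 1 by ring, Real.zero_rpow (by linarith)]
  ring

namespace IsDirichletSol

variable {n : ℕ} {u : EuclideanSpace ℝ (Fin n) → ℝ} {Ω : Set (EuclideanSpace ℝ (Fin n))}
  {F : ℝ → ℝ}

theorem integral_rpow_le (h : IsDirichletSol F u Ω) (hF : Continuous F) (hF0 : ∀ t, 0 ≤ F t)
    {C a : ℝ} (hC0 : 0 ≤ C) (ha : 1 ≤ a)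
    (hC : ∀ w : EuclideanSpace ℝ (Fin n) → ℝ, ContDiff ℝ 1 w → tsupport w ⊆ Ω →
      (∫ x, |w x| ^ (2 : ℝ)) ^ ((2 : ℝ) / 2) ≤ C * ∫ x, ‖fderiv ℝ w x‖ ^ 2) :
    ∫ x in Ω, u x ^ (2 * a) ≤
      C * (a ^ 2 / (2 * a - 1)) * ∫ x in Ω, F (u x) * u x ^ (2 * a - 1) := by
  have hk : Continuous fun s : ℝ => a * max 0 s ^ (a - 1) :=
    continuous_const.mul ((continuous_const.max continuous_id).rpow_const
      fun _ => Or.inr (by linarith))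
  have key := h.integral_sobolev_le hF hF0 two_pos hC0 hC hk
    fun t => by positivity
  simp only [integral_mul_rpow_sub_one ha (h.nonneg _),
    integral_sq_mul_rpow_sub_one ha (h.nonneg _), ← Real.rpow_mul (h.nonneg _), mul_comm a 2,
    mul_left_comm (F _)] at key
  rwa [integral_const_mul, ← mul_assoc, div_self (two_ne_zero' ℝ), Real.rpow_one] at key

end IsDirichletSol

/-- Bound on the `L^(a q)` norm of `f(u) - f(0)`, given the Sobolev inequality with exponent `q` and
the Poincaré inequality on `Ω`. The functions `F` and `φ` extend `f` and `f'` continuously beyond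
the range of `u`. -/
theorem exists_integral_sub_rpow_le {n : ℕ} {Ω : Set (EuclideanSpace ℝ (Fin n))}
    {a θ K' q CS CP : ℝ} (ha : 2 < a) (hθ : 0 < θ) (haθ : a ^ 2 < 2 * a + θ) (hK' : 0 ≤ K')
    (hq : 2 < q) (hCS0 : 0 ≤ CS) (hCP0 : 0 ≤ CP)
    (hCS : ∀ w : EuclideanSpace ℝ (Fin n) → ℝ, ContDiff ℝ 1 w → tsupport w ⊆ Ω →
      (∫ x, |w x| ^ q) ^ (2 / q) ≤ CS * ∫ x, ‖fderiv ℝ w x‖ ^ 2)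
    (hCP : ∀ w : EuclideanSpace ℝ (Fin n) → ℝ, ContDiff ℝ 1 w → tsupport w ⊆ Ω →
      (∫ x, |w x| ^ (2 : ℝ)) ^ ((2 : ℝ) / 2) ≤ CP * ∫ x, ‖fderiv ℝ w x‖ ^ 2) :
    ∃ L : ℝ, 0 < L ∧ ∀ (f f' f'' F φ : ℝ → ℝ) (u : EuclideanSpace ℝ (Fin n) → ℝ) (M : ℝ),
      C2On01 f f' f'' → (∀ t ∈ Ico (0 : ℝ) 1, 0 ≤ f t) → (∀ t ∈ Ico (0 : ℝ) 1, 0 ≤ f' t) →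
      (∀ t ∈ Ico (0 : ℝ) 1, 0 ≤ f'' t) →
      (∀ t ∈ Ico (0 : ℝ) 1, (1 + θ) * f' t ^ 2 - K' ≤ f'' t * (f t - f 0)) →
      M < 1 → (∀ x, u x ≤ M) → Continuous F → Continuous φ → (∀ t, 0 ≤ F t) → (∀ t, 0 ≤ φ t) →
      (∀ t ∈ Icc 0 M, F t = f t) → (∀ t ∈ Icc 0 M, φ t = f' t) →
      IsDirichletSol F u Ω → StableSol φ u Ω →
      (∫ x in Ω, (f (u x) - f 0) ^ (a * q)) ^ (1 / (a * q)) ≤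
        L * (f 0 + ∫ x in Ω, f' (u x) * f (u x)) := by
  have h1q : 2 * a < a * q := by nlinarith
  have hden : 0 < 2 * a + θ := by linarith
  obtain ⟨L, hL, hmain⟩ := exists_le_mul_of_absorption (m := 2 * a) (P := a * q)
    (κ := a ^ 2 / (2 * a + θ)) (K' := K') (c := CP * (a ^ 2 / (2 * a - 1))) (CS := CS)
    (V := volume.real Ω) (by linarith) h1q (by positivity) ((div_lt_one hden).2 haθ) hK'
    (mul_nonneg hCP0 (div_nonneg (by positivity) (by linarith))) hCS0 measureReal_nonneg
  refine ⟨L, hL, fun f f' f'' F φ u M hf hf0 hf'0 hf''0 hfK hM1 huM hF hφ hF0 hφ0 hFf hφf hu hst =>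
    ?_⟩
  have hbd := hu.isBounded
  have hu0 := hu.nonneg
  have huc := hu.continuous
  have hI : ∀ x, u x ∈ Ico (0 : ℝ) 1 := fun x => ⟨hu0 x, (huM x).trans_lt hM1⟩
  have hFu : ∀ x, F (u x) = f (u x) := fun x => hFf _ ⟨hu0 x, huM x⟩
  have hφu : ∀ x, φ (u x) = f' (u x) := fun x => hφf _ ⟨hu0 x, huM x⟩
  have hg : Continuous fun x => f (u x) := by simpa only [Function.comp_def, hFu] using hF.comp huc
  have hd : Continuous fun x => f' (u x) := by
    simpa only [Function.comp_def, hφu] using hφ.comp huc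
  have hy : Continuous fun x => f (u x) - f 0 := hg.sub continuous_const
  have hy0 : ∀ x, 0 ≤ f (u x) - f 0 := fun x => hf.sub_nonneg hf'0 (hI x)
  have hg0 : ∀ x, 0 ≤ f (u x) := fun x => hf0 _ (hI x)
  have hd0 : ∀ x, 0 ≤ f' (u x) := fun x => hf'0 _ (hI x)
  have hb : 0 ≤ f 0 := hf0 0 (by norm_num)
  have hyp : ∀ p : ℝ, 0 ≤ p → Continuous fun x => (f (u x) - f 0) ^ p := fun p hp =>
    hy.rpow_const fun _ => Or.inr hp
  have hgp : ∀ p : ℝ, 0 ≤ p → Continuous fun x => f (u x) ^ p := fun p hp =>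
    hg.rpow_const fun _ => Or.inr hp
  have hup : ∀ p : ℝ, 0 ≤ p → Continuous fun x => u x ^ p := fun p hp =>
    huc.rpow_const fun _ => Or.inr hp
  let k : ℝ → ℝ := fun s => a * max 0 (F s - f 0) ^ (a - 1) * φ s
  have hk : Continuous k := (continuous_const.mul ((continuous_const.max
    (hF.sub continuous_const)).rpow_const fun _ => Or.inr (by linarith))).mul hφ
  have hk0 : ∀ t, 0 ≤ k t := fun t => by
    have := hφ0 t
    positivity
  have hkf : ∀ x, ∀ s ∈ uIcc 0 (u x), k s = a * (f s - f 0) ^ (a - 1) * f' s := fun x s hs => by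
    rw [uIcc_of_le (hu0 x)] at hs
    have hs' : s ∈ Icc 0 M := ⟨hs.1, hs.2.trans (huM x)⟩
    simp only [k]
    rw [hFf s hs', hφf s hs',
      max_eq_right (hf.sub_nonneg hf'0 ⟨hs.1, hs'.2.trans_lt hM1⟩)]
  have hG : ∀ x, ∫ s in (0 : ℝ)..u x, k s = (f (u x) - f 0) ^ a := fun x => by
    rw [intervalIntegral.integral_congr (hkf x),
      hf.integral_rpow_mul_deriv (hI x) (by linarith)]
  have hH : ∀ x, ∫ s in (0 : ℝ)..u x, k s ^ 2 ≤ a ^ 2 / (2 * a + θ) *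
      (f' (u x) * (f (u x) - f 0) ^ (2 * a - 1) +
        K' * (u x * (f (u x) - f 0) ^ (2 * a - 2))) := fun x => by
    rw [intervalIntegral.integral_congr (g := fun s => (a * (f s - f 0) ^ (a - 1) * f' s) ^ 2)
      fun s hs => by simp only [hkf x s hs]]
    exact hf.integral_rpow_mul_deriv_sq_le hf'0 hθ hK' ha hfK (hI x)
  have hHc : Continuous fun x => ∫ s in (0 : ℝ)..u x, k s ^ 2 :=
    (hk.pow 2).continuous_primitive_zero.comp huc
  have hH0 : ∀ x, 0 ≤ ∫ s in (0 : ℝ)..u x, k s ^ 2 := fun x =>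
    intervalIntegral.integral_nonneg (hu0 x) fun s _ => sq_nonneg _
  have hstab := hu.integral_stable_le hF hF0 hφ hst hk hk0
  have hsob := hu.integral_sobolev_le hF hF0 (by linarith) hCS0 hCS hk hk0
  have hpoin := hu.integral_rpow_le hF hF0 hCP0 (by linarith : 1 ≤ a) hCP
  simp only [hG, hFu, hφu] at hstab hsob hpoin
  have hN : 0 ≤ ∫ x in Ω, (f (u x) - f 0) ^ (a * q) :=
    integral_nonneg fun x => Real.rpow_nonneg (hy0 x) _
  have hS : 0 ≤ ∫ x in Ω, f' (u x) * f (u x) :=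
    integral_nonneg fun x => mul_nonneg (hd0 x) (hg0 x)
  refine hmain (f 0) _ (∫ x in Ω, f' (u x) * (f (u x) - f 0) ^ (2 * a))
    (∫ x in Ω, f (u x) * (f' (u x) * (f (u x) - f 0) ^ (2 * a - 1)))
    (∫ x in Ω, f (u x) * (u x * (f (u x) - f 0) ^ (2 * a - 2)))
    (∫ x in Ω, (f (u x) - f 0) ^ (2 * a)) (∫ x in Ω, u x ^ (2 * a))
    (∫ x in Ω, f (u x) * u x ^ (2 * a - 1)) (∫ x in Ω, f (u x) ^ (2 * a)) _
    (∫ x in Ω, f (u x) * ∫ s in (0 : ℝ)..u x, k s ^ 2) hb hS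
    (integral_nonneg fun x => Real.rpow_nonneg (hu0 x) _) (by positivity)
    (integral_nonneg fun x => mul_nonneg (hg0 x) (hH0 x)) ?_ ?_ ?_ hpoin (fun ε hε => ?_) ?_
    (fun ε hε => ?_) ?_ (fun δ hδ s hs => ?_)
  · rw [← Real.rpow_mul hN, show 1 / (a * q) * (2 * a) = 2 / q by field_simp]
    simpa only [← Real.rpow_mul (hy0 _)] using hsob
  · simpa only [← Real.rpow_mul_natCast (hy0 _), Nat.cast_ofNat, mul_comm a 2] using hstab
  · rw [mul_add, ← mul_assoc]
    refine setIntegral_le_const_mul_add hbd (hg.mul hHc)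
      (hg.mul (hd.mul (hyp _ (by linarith)))) (hg.mul (huc.mul (hyp _ (by linarith)))) fun x => ?_
    refine (mul_le_mul_of_nonneg_left (hH x) (hg0 x)).trans (le_of_eq ?_)
    ring
  · rw [← mul_assoc (ε ^ _)]
    refine setIntegral_le_const_mul_add hbd (hg.mul (hd.mul (hyp _ (by linarith))))
      (hd.mul (hyp _ (by linarith))) (hd.mul hg) fun x => ?_
    have h1 := mul_rpow_sub_one_le hb (hy0 x) hε (show 1 < 2 * a by linarith)
    have h2 : ∀ {z : ℝ}, 0 ≤ z → z ^ (2 * a) = z * z ^ (2 * a - 1) := fun hz => by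
      rw [← Real.rpow_one_add' hz (by linarith)]
      congr 1
      ring
    have h3 : (f 0) ^ (2 * a) ≤ (f 0) ^ (2 * a - 1) * f (u x) := by
      rw [h2 hb, mul_comm]
      have := hy0 x
      gcongr
      linarith
    have h4 : f (u x) * (f (u x) - f 0) ^ (2 * a - 1) ≤ (1 + ε) * (f (u x) - f 0) ^ (2 * a) +
        ε ^ (-(2 * a - 1)) * ((f 0) ^ (2 * a - 1) * f (u x)) := by
      have h5 : f (u x) * (f (u x) - f 0) ^ (2 * a - 1) =
          (f (u x) - f 0) ^ (2 * a) + f 0 * (f (u x) - f 0) ^ (2 * a - 1) := by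
        rw [h2 (hy0 x)]
        ring
      have h6 := mul_le_mul_of_nonneg_left h3 (Real.rpow_nonneg hε.le (-(2 * a - 1)))
      linarith
    linarith [mul_le_mul_of_nonneg_left h4 (hd0 x)]
  · rw [← one_mul (∫ x in Ω, f (u x) ^ (2 * a)), ← one_mul (∫ x in Ω, u x ^ (2 * a))]
    refine setIntegral_le_const_mul_add hbd (hg.mul (huc.mul (hyp _ (by linarith))))
      (hgp _ (by linarith)) (hup _ (by linarith)) fun x => ?_
    have h1 := mul_rpow_sub_one_le (hu0 x) (hg0 x) one_pos (show 1 < 2 * a by linarith)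
    rw [Real.one_rpow] at h1
    refine le_trans ?_ h1
    have h2 : f (u x) ^ (2 * a - 1) = f (u x) * f (u x) ^ (2 * a - 2) := by
      rw [← Real.rpow_one_add' (hg0 x) (by linarith)]
      congr 1
      ring
    have h3 : (f (u x) - f 0) ^ (2 * a - 2) ≤ f (u x) ^ (2 * a - 2) :=
      Real.rpow_le_rpow (hy0 x) (by linarith) (by linarith)
    have h4 := mul_le_mul_of_nonneg_left h3 (mul_nonneg (hg0 x) (hu0 x))
    rw [h2]
    linarith
  · exact setIntegral_le_const_mul_add hbd (hg.mul (hup _ (by linarith))) (hup _ (by linarith))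
      (hgp _ (by linarith)) fun x =>
        mul_rpow_sub_one_le (hg0 x) (hu0 x) hε (by linarith)
  · have h1 := setIntegral_le_const_mul_add hbd (hgp (2 * a) (by linarith))
      (hyp (2 * a) (by linarith)) (continuous_const (y := (1 : ℝ))) (α := 2 ^ (2 * a))
      (β := 2 ^ (2 * a) * f 0 ^ (2 * a)) fun x => by
        simpa using add_rpow_le_two_rpow_mul (hy0 x) hb (show 0 ≤ 2 * a by linarith)
    refine h1.trans (le_of_eq ?_)
    rw [setIntegral_const, smul_eq_mul]
    ring
  · rw [← Real.rpow_mul hN, one_div_mul_cancel (by positivity), Real.rpow_one, mul_div_assoc',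
      mul_div_right_comm]
    have hB : Continuous fun x => s ^ (2 * a - a * q) * (f (u x) - f 0) ^ (a * q) +
        s ^ (2 * a - 1) / δ * (f' (u x) * f (u x)) :=
      (continuous_const.mul (hyp _ (by positivity))).add (continuous_const.mul (hd.mul hg))
    refine (setIntegral_le_const_mul_add hbd (hyp _ (by linarith)) (hup (2 * a) (by linarith)) hB
      (α := δ ^ (2 * a)) (β := 1) fun x => ?_).trans ?_
    · have hs0 : 0 ≤ s ^ (2 * a - 1) / δ := by positivity
      have hdg := mul_nonneg (hd0 x) (hg0 x)
      have hyP := Real.rpow_nonneg (hy0 x) (a * q)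
      rcases le_total (f' (u x)) δ with h | h
      · have h1 : f (u x) - f 0 ≤ δ * u x :=
          (hf.sub_le_deriv_mul hf''0 (hI x)).trans (mul_le_mul_of_nonneg_right h (hu0 x))
        have h2 : (f (u x) - f 0) ^ (2 * a) ≤ δ ^ (2 * a) * u x ^ (2 * a) := by
          rw [← Real.mul_rpow hδ.le (hu0 x)]
          exact Real.rpow_le_rpow (hy0 x) h1 (by linarith)
        exact h2.trans (le_add_of_nonneg_right (by positivity))
      · have h1 := rpow_le_interpolation (hy0 x) hs (show 1 < 2 * a by linarith) h1q
        have h2 : s ^ (2 * a - 1) * (f (u x) - f 0) ≤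
            s ^ (2 * a - 1) / δ * (f' (u x) * f (u x)) := by
          rw [div_mul_eq_mul_div, mul_div_assoc]
          gcongr
          rw [le_div_iff₀' hδ]
          exact mul_le_mul h (by linarith) (hy0 x) (hd0 x)
        have h3 : 0 ≤ δ ^ (2 * a) * u x ^ (2 * a) :=
          mul_nonneg (by positivity) (Real.rpow_nonneg (hu0 x) _)
        linarith
    · rw [one_mul]
      gcongr
      exact setIntegral_le_const_mul_add hbd hB (hyp _ (by positivity)) (hd.mul hg)
        fun x => le_rfl

theorem integral_rpow_rpow_inv_le {n : ℕ} {Ω : Set (EuclideanSpace ℝ (Fin n))}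
    (hΩ : IsBounded Ω) {g : EuclideanSpace ℝ (Fin n) → ℝ} (hg : Continuous g)
    (hg0 : ∀ x, 0 ≤ g x) {p P L R : ℝ} (hp : 0 < p) (hpP : p ≤ P) (hL : 0 < L) (hR : 0 ≤ R)
    (h : (∫ x in Ω, g x ^ P) ^ (1 / P) ≤ L * R) :
    (∫ x in Ω, g x ^ p) ^ (1 / p) ≤ (volume.real Ω + L ^ P) ^ (1 / p) * R := by
  have hP : 0 < P := hp.trans_le hpP
  have hV : 0 ≤ volume.real Ω := measureReal_nonneg
  have hLP : 0 < L ^ P := by positivity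
  have hC : 0 < (volume.real Ω + L ^ P) ^ (1 / p) := by positivity
  have hI : 0 ≤ ∫ x in Ω, g x ^ P := integral_nonneg fun x => Real.rpow_nonneg (hg0 x) _
  have hIp : 0 ≤ ∫ x in Ω, g x ^ p := integral_nonneg fun x => Real.rpow_nonneg (hg0 x) _
  rw [← div_le_iff₀' hC]
  refine le_of_forall_gt_imp_ge_of_dense fun r hr => ?_
  have hr0 : 0 < r := hR.trans_lt hr
  rw [div_le_iff₀' hC]
  have hIP : ∫ x in Ω, g x ^ P ≤ L ^ P * r ^ P := by
    rw [← Real.mul_rpow hL.le hr0.le]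
    calc ∫ x in Ω, g x ^ P = ((∫ x in Ω, g x ^ P) ^ (1 / P)) ^ P := by
          rw [← Real.rpow_mul hI, one_div_mul_cancel hP.ne', Real.rpow_one]
      _ ≤ (L * r) ^ P := by
          refine Real.rpow_le_rpow (Real.rpow_nonneg hI _) (h.trans ?_) hP.le
          gcongr
  have key : ∫ x in Ω, g x ^ p ≤ (volume.real Ω + L ^ P) * r ^ p := by
    have h1 := setIntegral_le_const_mul_add hΩ (hg.rpow_const fun _ => Or.inr hp.le)
      (continuous_const (y := (1 : ℝ))) (hg.rpow_const fun _ => Or.inr hP.le)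
      (α := r ^ p) (β := r ^ (p - P)) fun x => by
        rcases le_total (g x) r with hx | hx
        · have : g x ^ p ≤ r ^ p := Real.rpow_le_rpow (hg0 x) hx hp.le
          have := Real.rpow_nonneg (hg0 x) P
          have : 0 ≤ r ^ (p - P) * g x ^ P := by positivity
          linarith
        · have hgx : 0 < g x := hr0.trans_le hx
          have h2 : g x ^ p = g x ^ (p - P) * g x ^ P := by
            rw [← Real.rpow_add hgx]
            congr 1
            ring
          have h3 : g x ^ (p - P) * g x ^ P ≤ r ^ (p - P) * g x ^ P :=
            mul_le_mul_of_nonneg_right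
              (Real.rpow_le_rpow_of_nonpos hr0 hx (by linarith)) (by positivity)
          have : 0 ≤ r ^ p * 1 := by positivity
          linarith
    rw [setIntegral_const, smul_eq_mul] at h1
    have h4 : r ^ (p - P) * (L ^ P * r ^ P) = L ^ P * r ^ p := by
      rw [mul_left_comm, ← Real.rpow_add hr0, sub_add_cancel]
    have h5 := mul_le_mul_of_nonneg_left hIP (Real.rpow_nonneg hr0.le (p - P))
    linarith
  calc (∫ x in Ω, g x ^ p) ^ (1 / p) ≤ ((volume.real Ω + L ^ P) * r ^ p) ^ (1 / p) := by gcongr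
    _ = (volume.real Ω + L ^ P) ^ (1 / p) * r := by
      rw [Real.mul_rpow (by positivity) (by positivity), ← Real.rpow_mul hr0.le,
        mul_one_div_cancel hp.ne', Real.rpow_one]

theorem integral_rpow_rpow_inv_le_of_sub {n : ℕ} {Ω : Set (EuclideanSpace ℝ (Fin n))}
    (hΩ : IsBounded Ω) {g : EuclideanSpace ℝ (Fin n) → ℝ} (hg : Continuous g) {b : ℝ} (hb : 0 ≤ b)
    (hbg : ∀ x, b ≤ g x) {P : ℝ} (hP : 1 ≤ P) :
    (∫ x in Ω, g x ^ P) ^ (1 / P) ≤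
      2 * ((∫ x in Ω, (g x - b) ^ P) ^ (1 / P) + volume.real Ω ^ (1 / P) * b) := by
  have hP0 : 0 < P := by linarith
  have hI : 0 ≤ ∫ x in Ω, (g x - b) ^ P :=
    integral_nonneg fun x => Real.rpow_nonneg (sub_nonneg.2 (hbg x)) _
  have hIg : 0 ≤ ∫ x in Ω, g x ^ P :=
    integral_nonneg fun x => Real.rpow_nonneg (hb.trans (hbg x)) _
  have hV : 0 ≤ volume.real Ω := measureReal_nonneg
  have h1 := setIntegral_le_const_mul_add hΩ (hg.rpow_const fun _ => Or.inr hP0.le)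
    ((hg.sub continuous_const).rpow_const fun _ => Or.inr hP0.le)
    (continuous_const (y := (1 : ℝ))) (A := fun x => (g x - b) ^ P) (α := 2 ^ P)
    (β := 2 ^ P * b ^ P) fun x => by
      simpa using add_rpow_le_two_rpow_mul (sub_nonneg.2 (hbg x)) hb hP0.le
  rw [setIntegral_const, smul_eq_mul] at h1
  set N := (∫ x in Ω, (g x - b) ^ P) ^ (1 / P) with hN
  set T := volume.real Ω ^ (1 / P) * b with hT
  have hN0 : 0 ≤ N := by positivity
  have hT0 : 0 ≤ T := by positivity
  have hNP : N ^ P = ∫ x in Ω, (g x - b) ^ P := by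
    rw [hN, ← Real.rpow_mul hI, one_div_mul_cancel hP0.ne', Real.rpow_one]
  have hTP : T ^ P = volume.real Ω * b ^ P := by
    rw [hT, Real.mul_rpow (by positivity) hb, ← Real.rpow_mul hV, one_div_mul_cancel hP0.ne',
      Real.rpow_one]
  have h2 : ∫ x in Ω, g x ^ P ≤ (2 * (N + T)) ^ P := by
    have h3 := Real.add_rpow_le_rpow_add hN0 hT0 hP
    rw [hNP, hTP] at h3
    rw [Real.mul_rpow zero_le_two (by positivity)]
    refine le_trans ?_ (mul_le_mul_of_nonneg_left h3 (by positivity))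
    linarith
  calc (∫ x in Ω, g x ^ P) ^ (1 / P) ≤ ((2 * (N + T)) ^ P) ^ (1 / P) := by gcongr
    _ = 2 * (N + T) := by
      rw [← Real.rpow_mul (by positivity), mul_one_div_cancel hP0.ne', Real.rpow_one]

theorem lap_congr {n : ℕ} {u v : EuclideanSpace ℝ (Fin n) → ℝ} {x : EuclideanSpace ℝ (Fin n)}
    (h : u =ᶠ[𝓝 x] v) : lap u x = lap v x := by
  refine Finset.sum_congr rfl fun i _ => ?_
  have : (fun y => fderiv ℝ u y (EuclideanSpace.single i 1)) =ᶠ[𝓝 x]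
      fun y => fderiv ℝ v y (EuclideanSpace.single i 1) := by
    filter_upwards [h.fderiv (𝕜 := ℝ)] with y hy
    rw [hy]
  rw [this.fderiv_eq]

/-- Global `L^p̄` estimate for `f(u)` (Proposition 1.6): for stable solutions of
the Dirichlet problem in a smooth bounded domain `Ω`, with `f ≥ 0`, `f' ≥ 0`, `f'' ≥ 0`,
`f(1⁻) = +∞`, `f''f ≥ (1+θ)f'² - K` and `f''(f - f(0)) ≥ (1+θ)f'² - K̃`, and
`β ∈ (0, √(1+θ)-1)`, `p̄ = (2+β)·2n/(n-2)` for `n ≥ 3` (`p̄ ≥ 1` arbitrary for `n ≤ 2`),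
one has `‖f(u)‖_{L^p̄(Ω)} ≤ C (f(0) + ‖f'(u)f(u)‖_{L¹(Ω)})`, `C = C(Ω, θ, K, K̃, β, p̄)`. -/
theorem stmt4 (n : ℕ) (hn : 1 ≤ n) (Ω : Set (EuclideanSpace ℝ (Fin n)))
    (hΩ : SmoothBoundedDomain Ω) (θ K K' β p : ℝ) (hθ : 0 < θ) (hK : 0 ≤ K) (hK' : 0 ≤ K')
    (hβ : β ∈ Ioo 0 (Real.sqrt (1 + θ) - 1))
    (hp : (3 ≤ n ∧ p = (2 + β) * (2 * (n:ℝ)) / ((n:ℝ) - 2)) ∨ (n ≤ 2 ∧ 1 ≤ p)) :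
    ∃ C : ℝ, 0 < C ∧
      ∀ (f f' f'' : ℝ → ℝ) (u : EuclideanSpace ℝ (Fin n) → ℝ),
        C2On01 f f' f'' →
        (∀ t ∈ Ico (0:ℝ) 1, 0 ≤ f t) →
        (∀ t ∈ Ico (0:ℝ) 1, 0 ≤ f' t) →
        (∀ t ∈ Ico (0:ℝ) 1, 0 ≤ f'' t) →
        Tendsto f (𝓝[<] (1:ℝ)) atTop →
        (∀ t ∈ Ico (0:ℝ) 1, (1 + θ) * f' t ^ 2 - K ≤ f'' t * f t) →
        (∀ t ∈ Ico (0:ℝ) 1, (1 + θ) * f' t ^ 2 - K' ≤ f'' t * (f t - f 0)) →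
        ContinuousOn u (closure Ω) → ContDiffOn ℝ 2 u Ω →
        (∀ x ∈ Ω, 0 ≤ u x ∧ u x < 1) →
        (∀ x ∈ Ω, -lap u x = f (u x)) →
        (∀ x ∈ frontier Ω, u x = 0) →
        StableSol f' u Ω →
        (∫ x in Ω, f (u x) ^ p) ^ (1/p) ≤
          C * (f 0 + ∫ x in Ω, f' (u x) * f (u x)) := by
  have ha : 2 < 2 + β := by linarith [hβ.1]
  have haθ : (2 + β) ^ 2 < 2 * (2 + β) + θ := by
    have h1 : 1 + β < √(1 + θ) := by linarith [hβ.2]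
    have h2 := Real.sq_sqrt (show 0 ≤ 1 + θ by linarith)
    nlinarith [hβ.1]
  obtain ⟨q, hq, hqn, hp0, hpq⟩ : ∃ q : ℝ, 2 < q ∧ (2 : ℝ)⁻¹ - (n : ℝ)⁻¹ ≤ q⁻¹ ∧ 0 < p ∧
      p ≤ (2 + β) * q := by
    rcases hp with ⟨hn3, rfl⟩ | ⟨hn2, hp1⟩
    · have hn3' : (3 : ℝ) ≤ n := by exact_mod_cast hn3
      have hn2 : 0 < (n : ℝ) - 2 := by linarith
      refine ⟨2 * n / (n - 2), ?_, ?_, by positivity, (mul_div_assoc _ _ _).le⟩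
      · rw [lt_div_iff₀ hn2]
        linarith
      · refine le_of_eq ?_
        field_simp
    · refine ⟨p + 4, by linarith, ?_, by linarith, by nlinarith⟩
      have h1 : (2 : ℝ)⁻¹ ≤ (n : ℝ)⁻¹ := by
        have : (0 : ℝ) < n := by exact_mod_cast hn
        gcongr
        exact_mod_cast hn2
      have h2 : 0 ≤ (p + 4)⁻¹ := by positivity
      linarith
  obtain ⟨hΩo, hΩb, hΩc, -⟩ := hΩ
  obtain ⟨CS, hCS0, hCS⟩ := sobolev_inequality_integral hn hΩb hq.le hqn
  obtain ⟨CP, hCP0, hCP⟩ := sobolev_inequality_integral hn hΩb le_rfl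
    (sub_le_self _ (by positivity))
  obtain ⟨L, hL, hmain⟩ := exists_integral_sub_rpow_le ha hθ haθ hK' hq hCS0 hCP0 hCS hCP
  have hP1 : 1 ≤ (2 + β) * q := by nlinarith
  set P := (2 + β) * q
  have hV : 0 ≤ volume.real Ω := measureReal_nonneg
  refine ⟨(volume.real Ω + (2 * (L + volume.real Ω ^ (1 / P))) ^ P) ^ (1 / p), by positivity,
    fun f f' f'' u hf hf0 hf'0 hf''0 _ _ hfK huc hu2 hu01 hlap hu0 hst => ?_⟩
  obtain ⟨x₀, hx₀, hmax⟩ := hΩb.isCompact_closure.exists_isMaxOn hΩc.nonempty.closure huc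
  set M := u x₀
  have hM1 : M < 1 := by
    rw [closure_eq_self_union_frontier] at hx₀
    rcases hx₀ with h | h
    · exact (hu01 _ h).2
    · simp [M, hu0 _ h]
  have huM : ∀ x ∈ Ω, u x ≤ M := fun x hx => hmax (subset_closure hx)
  have hM0 : 0 ≤ M := by
    obtain ⟨y, hy⟩ := hΩc.nonempty
    exact (hu01 y hy).1.trans (huM y hy)
  have hcl : ∀ t, max 0 (min M t) ∈ Ico (0 : ℝ) 1 := fun t =>
    ⟨le_max_left _ _, max_lt one_pos ((min_le_left _ _).trans_lt hM1)⟩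
  have hcle : ∀ t ∈ Icc 0 M, max 0 (min M t) = t := fun t ht => by
    rw [min_eq_right ht.2, max_eq_right ht.1]
  have hcc : Continuous fun t : ℝ => max 0 (min M t) := by fun_prop
  let v := Ω.indicator u
  have hvu : ∀ x ∈ Ω, v x = u x := fun x hx => indicator_of_mem hx u
  have hveq : ∀ x ∈ Ω, v =ᶠ[𝓝 x] u := fun x hx => by
    filter_upwards [hΩo.mem_nhds hx] with y hy using hvu y hy
  have hv0 : ∀ x, 0 ≤ v x := indicator_nonneg fun x hx => (hu01 x hx).1
  have hvM : ∀ x, v x ≤ M := fun x => indicator_apply_le' (huM x) fun _ => hM0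
  have hv : IsDirichletSol (fun t => f (max 0 (min M t))) v Ω :=
    { isOpen := hΩo
      isBounded := hΩb
      continuous := continuous_indicator hu0 huc
      eq_zero := fun x hx => indicator_of_notMem hx u
      contDiffOn := hu2.congr hvu
      neg_lap_eq := fun x hx => by
        rw [lap_congr (hveq x hx), hlap x hx, hcle _ ⟨hv0 x, hvM x⟩, hvu x hx]
      nonneg := hv0 }
  have hvst : StableSol (fun t => f' (max 0 (min M t))) v Ω := fun ξ h1 h2 h3 => by
    refine (hst ξ h1 h2 h3).trans (le_of_eq (setIntegral_congr_fun hΩo.measurableSet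
      fun x hx => ?_))
    have h4 := hcle _ ⟨hv0 x, hvM x⟩
    rw [hvu x hx] at h4
    simp only [hvu x hx, h4]
  have hFc := hf.continuousOn.comp_continuous hcc hcl
  have key := hmain f f' f'' (fun t => f (max 0 (min M t))) (fun t => f' (max 0 (min M t))) v M
    hf hf0 hf'0 hf''0 hfK hM1 hvM hFc (hf.continuousOn_deriv.comp_continuous hcc hcl)
    (fun t => hf0 _ (hcl t)) (fun t => hf'0 _ (hcl t)) (fun t ht => by simp only [hcle t ht])
    (fun t ht => by simp only [hcle t ht]) hv hvst
  have hvI : ∀ x, v x ∈ Ico (0 : ℝ) 1 := fun x => ⟨hv0 x, (hvM x).trans_lt hM1⟩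
  have hg : Continuous fun x => f (v x) := hf.continuousOn.comp_continuous hv.continuous hvI
  have hb : 0 ≤ f 0 := hf0 0 (by norm_num)
  have hS : 0 ≤ ∫ x in Ω, f' (v x) * f (v x) :=
    integral_nonneg fun x => mul_nonneg (hf'0 _ (hvI x)) (hf0 _ (hvI x))
  rw [setIntegral_congr_fun (g := fun x => f (v x) ^ p) hΩo.measurableSet fun x hx => by
      simp only [hvu x hx],
    setIntegral_congr_fun (f := fun x => f' (u x) * f (u x)) (g := fun x => f' (v x) * f (v x))
      hΩo.measurableSet fun x hx => by simp only [hvu x hx]]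
  refine integral_rpow_rpow_inv_le hΩb hg (fun x => hf0 _ (hvI x)) hp0 hpq (by positivity)
    (by positivity) ?_
  refine (integral_rpow_rpow_inv_le_of_sub hΩb hg hb
    (fun x => sub_nonneg.1 (hf.sub_nonneg hf'0 (hvI x))) hP1).trans ?_
  have h1 : 0 ≤ volume.real Ω ^ (1 / P) * ∫ x in Ω, f' (v x) * f (v x) := by positivity
  linarith
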